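/- For every n ≥ 1 and every m ∈ {n, …, 2n−1}, there is an n-regular acyclic Borel bipartite graph G such that the Borel edge chromatic number χ'_B(G) equals m. -/

import Mathlib

/-- The left shift action of a group `G` on the product space `G → X`:
`(γ • y) β = y (γ⁻¹ * β)`. -/
def shift {G : Type*} [Group G] {X : Type*} (γ : G) (y : G → X) : G → X :=
  fun β => y (γ⁻¹ * β)

/-- The free part `Free(X^G)` of the left shift action of `G` on `G → X`. -/
def freePart (G : Type*) [Group G] (X : Type*) : Set (G → X) :=
  {y | ∀ γ : G, γ ≠ 1 → shift γ y ≠ y}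

/-- The Borel chromatic number of a (graph given by a) relation `G` on a measurable
space `X`: the least cardinality of a standard Borel space `Y` admitting a Borel
(measurable) coloring `c : X → Y` with `c x ≠ c y` whenever `G x y`. -/
noncomputable def borelChromaticNumber {X : Type} [mX : MeasurableSpace X]
    (G : X → X → Prop) : Cardinal :=
  sInf {κ : Cardinal | ∃ (Y : Type) (mY : MeasurableSpace Y),
    @StandardBorelSpace Y mY ∧ Cardinal.mk Y = κ ∧
    ∃ c : X → Y, @Measurable X Y mX mY c ∧ ∀ x y, G x y → c x ≠ c y}

/-- The adjacency relation of the graph `G(Γ, X)` on the free part `Free(X^Γ)` determined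
by a set `S` of generators of `Γ`: `x` and `y` are adjacent iff some `γ ∈ S` shifts `x`
to `y` or `y` to `x`. -/
def cayleyAdj {Γ : Type} [Group Γ] (S : Set Γ) (X : Type) :
    ↥(freePart Γ X) → ↥(freePart Γ X) → Prop :=
  fun x y => ∃ γ ∈ S,
    shift γ (x : Γ → X) = (y : Γ → X) ∨ shift γ (y : Γ → X) = (x : Γ → X)

/-- The Borel edge chromatic number of a (graph given by a) relation `G` on a measurable
space `X`, i.e. the Borel chromatic number of the dual graph of `G`: the least
cardinality of a standard Borel space `Y` admitting a Borel map `c : X × X → Y` that is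
symmetric on edges (so it descends to a coloring of the unordered edges) and assigns
different colors to distinct intersecting edges. -/
noncomputable def borelEdgeChromaticNumber {X : Type} [mX : MeasurableSpace X]
    (G : X → X → Prop) : Cardinal :=
  sInf {κ : Cardinal | ∃ (Y : Type) (mY : MeasurableSpace Y),
    @StandardBorelSpace Y mY ∧ Cardinal.mk Y = κ ∧
    ∃ c : X × X → Y,
      @Measurable (X × X) Y (@Prod.instMeasurableSpace X X mX mX) mY c ∧
      (∀ x y, G x y → c (x, y) = c (y, x)) ∧
      (∀ x y z, G x y → G x z → y ≠ z → c (x, y) ≠ c (x, z))}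

/-- A forest of positions of an infinite two-player game: every position has a level, a parent
and at least one child. -/
structure GameTree where
  Pos : Type
  lvl : Pos → ℕ
  par : Pos → Pos
  lvl_par : ∀ q, lvl (par q) = lvl q - 1
  exists_child : ∀ q, ∃ c, par c = q ∧ lvl c = lvl q + 1

namespace GameTree

variable (T : GameTree)

/-- `c` is a position reached from `q` by one move. -/
def IsChild (c q : T.Pos) : Prop := T.par c = q ∧ T.lvl c = T.lvl q + 1

/-- An infinite play. -/
def IsPlay (x : ℕ → T.Pos) : Prop := ∀ n, T.lvl (x n) = n ∧ T.par (x (n + 1)) = x n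

/-- A strategy, prescribing a move at every position (for either player). -/
structure Strat where
  move : T.Pos → T.Pos
  isChild : ∀ q, T.IsChild (move q) q

/-- The play `x` follows `f` at the turns of player `b` from level `N` on; the player `false`
moves at even levels, the player `true` at odd levels. -/
def FollowsFrom {T : GameTree} (N : ℕ) (b : Bool) (f : T.Pos → T.Pos) (x : ℕ → T.Pos) : Prop :=
  ∀ n, N ≤ n → n % 2 = b.toNat → x (n + 1) = f (x n)

/-- The ancestor of `q` at level `m`. -/
def anc (q : T.Pos) (m : ℕ) : T.Pos := T.par^[T.lvl q - m] q

/-- The set of plays `W` is decided by the position at some fixed level. -/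
def Decided (W : Set (ℕ → T.Pos)) : Prop :=
  ∃ N, ∃ Z : Set T.Pos, ∀ x, T.IsPlay x → (x ∈ W ↔ x N ∈ Z)

variable {T}

/-- A child of `q`. -/
noncomputable def someChild (q : T.Pos) : T.Pos := (T.exists_child q).choose

lemma isChild_someChild (q : T.Pos) : T.IsChild (someChild q) q := (T.exists_child q).choose_spec

instance : Nonempty T.Strat := ⟨⟨someChild, isChild_someChild⟩⟩

lemma IsPlay.isChild {x : ℕ → T.Pos} (hx : T.IsPlay x) (n : ℕ) : T.IsChild (x (n + 1)) (x n) :=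
  ⟨(hx n).2, by rw [(hx _).1, (hx _).1]⟩

lemma lvl_iterate_par (q : T.Pos) (j : ℕ) : T.lvl (T.par^[j] q) = T.lvl q - j := by
  induction j with
  | zero => rfl
  | succ j ih => rw [Function.iterate_succ_apply', T.lvl_par, ih]; omega

lemma lvl_anc {q : T.Pos} {m : ℕ} (h : m ≤ T.lvl q) : T.lvl (T.anc q m) = m := by
  rw [anc, lvl_iterate_par]; omega

lemma anc_of_le {q : T.Pos} {m : ℕ} (h : T.lvl q ≤ m) : T.anc q m = q := by
  rw [anc, Nat.sub_eq_zero_of_le h]; rfl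

lemma anc_self (q : T.Pos) : T.anc q (T.lvl q) = q := anc_of_le le_rfl

lemma IsChild.anc {c q : T.Pos} (h : T.IsChild c q) {m : ℕ} (hm : m ≤ T.lvl q) :
    T.anc c m = T.anc q m := by
  rw [GameTree.anc, GameTree.anc, h.2, Nat.succ_sub hm, Function.iterate_succ_apply, h.1]

lemma anc_anc {q : T.Pos} {m k : ℕ} (h : k ≤ m) : T.anc (T.anc q m) k = T.anc q k := by
  rcases le_total (T.lvl q) m with h1 | h1
  · rw [anc_of_le h1]
  · rw [anc, lvl_anc h1, anc, ← Function.iterate_add_apply, anc]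
    congr 1; omega

lemma anc_par {q : T.Pos} {m : ℕ} (h : m < T.lvl q) : T.anc (T.par q) m = T.anc q m := by
  have : T.par q = T.anc q (T.lvl q - 1) := by
    rw [anc, show T.lvl q - (T.lvl q - 1) = 1 by omega]; rfl
  rw [this, anc_anc (by omega)]

lemma isChild_par {q : T.Pos} (h : 0 < T.lvl q) : T.IsChild q (T.par q) :=
  ⟨rfl, by rw [T.lvl_par]; omega⟩

lemma isChild_anc_succ {q : T.Pos} {m : ℕ} (h : m < T.lvl q) :
    T.IsChild (T.anc q (m + 1)) (T.anc q m) := by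
  refine ⟨?_, by rw [lvl_anc h, lvl_anc h.le]⟩
  rw [anc, anc, ← Function.iterate_succ_apply' T.par]
  congr 1; omega

lemma IsPlay.anc {x : ℕ → T.Pos} (hx : T.IsPlay x) {m n : ℕ} (h : m ≤ n) :
    T.anc (x n) m = x m := by
  induction n, h using Nat.le_induction with
  | base => exact anc_of_le (hx m).1.le
  | succ n hn ih => rw [(hx.isChild n).anc (by rwa [(hx n).1]), ih]

/-- Every position lies on a play that follows a given strategy afterwards. -/
lemma Strat.exists_play (σ : T.Strat) (q : T.Pos) :
    ∃ x, T.IsPlay x ∧ x (T.lvl q) = q ∧ ∀ n, T.lvl q ≤ n → x (n + 1) = σ.move (x n) := by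
  have hl : ∀ j, T.lvl (σ.move^[j] q) = T.lvl q + j := by
    intro j
    induction j with
    | zero => rfl
    | succ j ih => rw [Function.iterate_succ_apply', (σ.isChild _).2, ih]; omega
  refine ⟨fun n => if n ≤ T.lvl q then T.anc q n else σ.move^[n - T.lvl q] q, ?_, ?_, ?_⟩
  · intro n
    constructor
    · dsimp only
      split_ifs with h
      · exact lvl_anc h
      · rw [hl]; omega
    · rcases lt_trichotomy n (T.lvl q) with h | h | h
      · simp only [h.le, if_true, Nat.succ_le_of_lt h]
        exact (isChild_anc_succ h).1
      · subst h
        simp [anc_self, (σ.isChild q).1]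
      · have h1 : ¬ n ≤ T.lvl q := by omega
        have h2 : ¬ n + 1 ≤ T.lvl q := by omega
        simp only [h1, h2, if_false]
        rw [show n + 1 - T.lvl q = (n - T.lvl q) + 1 by omega, Function.iterate_succ_apply',
          (σ.isChild _).1]
  · simp [anc_self]
  · intro n hn
    have h2 : ¬ n + 1 ≤ T.lvl q := by omega
    dsimp only
    rw [if_neg h2, show n + 1 - T.lvl q = (n - T.lvl q) + 1 by omega,
      Function.iterate_succ_apply']
    split_ifs with h
    · obtain rfl : n = T.lvl q := by omega
      simp [anc_self]
    · rfl

/-- `σ` forces every play through `q` into `U`, when used by player `b` from `q` on. -/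
def Strat.Forces (σ : T.Strat) (b : Bool) (U : Set T.Pos) (q : T.Pos) : Prop :=
  ∀ x, T.IsPlay x → x (T.lvl q) = q → FollowsFrom (T.lvl q) b σ.move x →
    ∃ n, T.lvl q ≤ n ∧ x n ∈ U

/-- The positions from which player `b` can force the play into `U`. -/
def forced (b : Bool) (U : Set T.Pos) : Set T.Pos := {q | ∃ σ : T.Strat, σ.Forces b U q}

lemma subset_forced (b : Bool) (U : Set T.Pos) : U ⊆ forced b U := fun q hq =>
  ⟨Classical.arbitrary _, fun x _ hxq _ => ⟨_, le_rfl, by rwa [hxq]⟩⟩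

lemma exists_descendant_of_forced {b : Bool} {U : Set T.Pos} {q : T.Pos} (h : q ∈ forced b U) :
    ∃ u ∈ U, T.lvl q ≤ T.lvl u ∧ T.anc u (T.lvl q) = q := by
  obtain ⟨σ, hσ⟩ := h
  obtain ⟨x, hx, hxq, hf⟩ := σ.exists_play q
  obtain ⟨n, hn, hU⟩ := hσ x hx hxq fun n hn _ => hf n hn
  exact ⟨x n, hU, by rwa [(hx n).1], by rw [hx.anc hn, hxq]⟩

open Classical in
lemma forced_of_child {b : Bool} {U : Set T.Pos} {q c : T.Pos} (hq : T.lvl q % 2 = b.toNat)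
    (hc : T.IsChild c q) (h : c ∈ forced b U) : q ∈ forced b U := by
  obtain ⟨σ, hσ⟩ := h
  refine ⟨⟨fun p => if p = q then c else σ.move p, fun p => ?_⟩, ?_⟩
  · split_ifs with h
    · rwa [h]
    · exact σ.isChild p
  · intro x hx hxq hf
    have h1 : x (T.lvl c) = c := by
      rw [hc.2, hf _ le_rfl hq]; simp [hxq]
    obtain ⟨n, hn, hU⟩ := hσ x hx h1 fun n hn hb => by
      have := hc.2
      rw [hf n (by omega) hb]
      refine if_neg fun h => ?_
      have := (hx n).1
      rw [h] at this
      omega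
    exact ⟨n, by have := hc.2; omega, hU⟩

open Classical in
lemma forced_of_forall_child {b : Bool} {U : Set T.Pos} {q : T.Pos}
    (h : ∀ c, T.IsChild c q → c ∈ forced b U) : q ∈ forced b U := by
  have h' : ∀ c : T.Pos, ∃ σ : T.Strat, T.IsChild c q → σ.Forces b U c := by
    intro c
    by_cases hc : T.IsChild c q
    · obtain ⟨σ, hσ⟩ := h c hc
      exact ⟨σ, fun _ => hσ⟩
    · exact ⟨Classical.arbitrary _, fun h => absurd h hc⟩
  choose σ hσ using h'
  refine ⟨⟨fun p => (σ (T.anc p (T.lvl q + 1))).move p, fun p => (σ _).isChild p⟩, ?_⟩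
  intro x hx hxq hf
  have hc : T.IsChild (x (T.lvl q + 1)) q := by simpa [hxq] using hx.isChild (T.lvl q)
  obtain ⟨n, hn, hU⟩ := hσ _ hc x hx (by rw [hc.2]) fun n hn hb => by
    rw [hc.2] at hn
    rw [hf n (by omega) hb]
    show (σ (T.anc (x n) (T.lvl q + 1))).move (x n) = _
    rw [hx.anc hn]
  exact ⟨n, by rw [hc.2] at hn; omega, hU⟩

/-- A strategy forcing the play from `q` into `U`, if there is one. -/
noncomputable def forcing (b : Bool) (U : Set T.Pos) (q : T.Pos) : T.Strat :=
  Classical.epsilon fun σ => σ.Forces b U q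

lemma forces_forcing {b : Bool} {U : Set T.Pos} {q : T.Pos} (h : q ∈ forced b U) :
    (forcing b U q).Forces b U q := Classical.epsilon_spec h

open Classical in
/-- Once a position of `U` has been visited, move according to `g`; otherwise, if from some
visited position of level at least `N` the set `U` could be forced, carry out a strategy doing so;
otherwise move according to `h`. -/
noncomputable def phased (b : Bool) (U : Set T.Pos) (N : ℕ) (g : T.Pos → T.Pos → T.Pos)
    (h : T.Pos → T.Pos) (q : T.Pos) : T.Pos :=
  if h1 : ∃ m, m ≤ T.lvl q ∧ T.anc q m ∈ U then g (T.anc q (Nat.find h1)) q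
  else if h2 : ∃ m, N ≤ m ∧ m ≤ T.lvl q ∧ T.anc q m ∈ forced b U then
    (forcing b U (T.anc q (Nat.find h2))).move q
  else h q

lemma isChild_phased {b : Bool} {U : Set T.Pos} {N : ℕ} {g : T.Pos → T.Pos → T.Pos}
    {h : T.Pos → T.Pos} (hg : ∀ u q, T.IsChild (g u q) q) (hh : ∀ q, T.IsChild (h q) q)
    (q : T.Pos) : T.IsChild (phased b U N g h q) q := by
  unfold phased
  split_ifs
  · exact hg _ _
  · exact Strat.isChild _ _
  · exact hh _

lemma FollowsFrom.phased_cases {b : Bool} {U : Set T.Pos} {N : ℕ} {g : T.Pos → T.Pos → T.Pos}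
    {h : T.Pos → T.Pos} (hU : ∀ u ∈ U, N ≤ T.lvl u) {x : ℕ → T.Pos} (hx : T.IsPlay x)
    (hf : FollowsFrom N b (phased b U N g h) x) :
    ((∀ m, N ≤ m → x m ∉ forced b U) ∧ FollowsFrom N b h x) ∨
      ∃ k, N ≤ k ∧ x k ∈ U ∧ FollowsFrom k b (g (x k)) x := by
  classical
  by_cases hex : ∃ m, x m ∈ U
  · right
    have hk := Nat.find_spec hex
    have hN : N ≤ Nat.find hex := by simpa [(hx _).1] using hU _ hk
    refine ⟨Nat.find hex, hN, hk, fun n hn hb => ?_⟩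
    rw [hf n (hN.trans hn) hb]
    have h1 : ∃ m, m ≤ T.lvl (x n) ∧ T.anc (x n) m ∈ U :=
      ⟨Nat.find hex, by rwa [(hx n).1], by rwa [hx.anc hn]⟩
    rw [phased, dif_pos h1]
    have h2 := Nat.find_spec h1
    have h4 : Nat.find h1 ≤ n := h2.1.trans_eq (hx n).1
    have h3 : Nat.find h1 = Nat.find hex := by
      apply le_antisymm
      · exact Nat.find_min' _ ⟨by rwa [(hx n).1], by rwa [hx.anc hn]⟩
      · exact Nat.find_min' _ (by rw [hx.anc h4] at h2; exact h2.2)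
    rw [hx.anc h4, h3]
  · left
    have hno : ∀ n, ¬ ∃ m, m ≤ T.lvl (x n) ∧ T.anc (x n) m ∈ U := by
      rintro n ⟨m, hm, hmU⟩
      rw [(hx n).1] at hm
      exact hex ⟨m, by rwa [hx.anc hm] at hmU⟩
    have hV : ¬ ∃ m, N ≤ m ∧ x m ∈ forced b U := by
      intro hV
      obtain ⟨hk1, hk2⟩ := Nat.find_spec hV
      set k := Nat.find hV with hkdef
      obtain ⟨n, -, hn⟩ := forces_forcing hk2 x hx (by rw [(hx _).1]) fun n hn hb => by
        rw [(hx _).1] at hn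
        rw [hf n (hk1.trans hn) hb, phased, dif_neg (hno n)]
        have h2 : ∃ m, N ≤ m ∧ m ≤ T.lvl (x n) ∧ T.anc (x n) m ∈ forced b U :=
          ⟨k, hk1, by rwa [(hx n).1], by rwa [hx.anc hn]⟩
        rw [dif_pos h2]
        have h3 := Nat.find_spec h2
        have h4 : Nat.find h2 ≤ n := by simpa [(hx n).1] using h3.2.1
        have h5 : Nat.find h2 = k := by
          apply le_antisymm
          · exact Nat.find_min' _ ⟨hk1, by rwa [(hx n).1], by rwa [hx.anc hn]⟩
          · exact Nat.find_min' _ ⟨h3.1, by simpa [hx.anc h4] using h3.2.2⟩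
        rw [hx.anc h4, h5]
      exact hex ⟨n, hn⟩
    refine ⟨fun m hm hmV => hV ⟨m, hm, hmV⟩, fun n hn hb => ?_⟩
    rw [hf n hn hb, phased, dif_neg (hno n), dif_neg]
    rintro ⟨m, h1, h2, h3⟩
    rw [(hx n).1] at h2
    exact hV ⟨m, h1, by rwa [hx.anc h2] at h3⟩

/-- A level-preserving map of trees. -/
structure Hom (S T : GameTree) where
  map : S.Pos → T.Pos
  lvl_map : ∀ q, T.lvl (map q) = S.lvl q
  map_par : ∀ q, map (S.par q) = T.par (map q)

namespace Hom
variable {S T R : GameTree}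

lemma isPlay (f : Hom S T) {x : ℕ → S.Pos} (hx : S.IsPlay x) : T.IsPlay fun n => f.map (x n) :=
  fun n => ⟨by rw [f.lvl_map, (hx n).1], by rw [← f.map_par, (hx n).2]⟩

lemma isChild (f : Hom S T) {c q : S.Pos} (h : S.IsChild c q) : T.IsChild (f.map c) (f.map q) :=
  ⟨by rw [← f.map_par, h.1], by rw [f.lvl_map, f.lvl_map, h.2]⟩

/-- The plays mapped into `W`. -/
def pre (f : Hom S T) (W : Set (ℕ → T.Pos)) : Set (ℕ → S.Pos) := {x | (fun n => f.map (x n)) ∈ W}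

/-- Composition of maps of trees. -/
def comp (f : Hom S T) (g : Hom R S) : Hom R T where
  map := f.map ∘ g.map
  lvl_map q := by simp [f.lvl_map, g.lvl_map]
  map_par q := by simp [f.map_par, g.map_par]

/-- The identity map. -/
def id (T : GameTree) : Hom T T := ⟨_root_.id, fun _ => rfl, fun _ => rfl⟩

lemma decided_pre (f : Hom S T) {W : Set (ℕ → T.Pos)} (h : T.Decided W) : S.Decided (f.pre W) := by
  obtain ⟨N, Z, h⟩ := h
  exact ⟨N, f.map ⁻¹' Z, fun x hx => h _ (f.isPlay hx)⟩

end Hom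

/-- A covering in the sense of Martin. -/
structure Cover (S T : GameTree) extends Hom S T where
  lower : Bool → S.Strat → T.Strat
  causal : ∀ b σ σ' q, (∀ s, S.lvl s ≤ T.lvl q → S.lvl s % 2 = b.toNat → σ.move s = σ'.move s) →
    T.lvl q % 2 = b.toNat → (lower b σ).move q = (lower b σ').move q
  lift : ∀ b σ x, T.IsPlay x → FollowsFrom 0 b (lower b σ).move x →
    ∃ y, S.IsPlay y ∧ FollowsFrom 0 b σ.move y ∧ ∀ n, map (y n) = x n

/-- A covering that is trivial up to level `k`. -/
def Cover.TrivialUpTo {S T : GameTree} (C : Cover S T) (k : ℕ) : Prop :=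
  (∀ q, T.lvl q ≤ k → ∃! s, C.map s = q) ∧
    ∀ b σ s, S.lvl s < k → S.lvl s % 2 = b.toNat → (C.lower b σ).move (C.map s) = C.map (σ.move s)

namespace Cover
variable {S T R : GameTree}

/-- The identity covering. -/
def id (T : GameTree) : Cover T T where
  toHom := Hom.id T
  lower _ σ := σ
  causal _ _ _ q h hq := h q le_rfl hq
  lift _ _ x hx hf := ⟨x, hx, hf, fun _ => rfl⟩

lemma trivialUpTo_id (T : GameTree) (k : ℕ) : (id T).TrivialUpTo k :=
  ⟨fun q _ => ⟨q, rfl, fun _ h => h⟩, fun _ _ _ _ _ => rfl⟩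

/-- Composition of coverings. -/
def comp (C : Cover S T) (D : Cover R S) : Cover R T where
  toHom := C.toHom.comp D.toHom
  lower b σ := C.lower b (D.lower b σ)
  causal b σ σ' q h hq := C.causal b _ _ q
    (fun s hs hb => D.causal b _ _ s (fun r hr => h r (hr.trans hs)) hb) hq
  lift b σ x hx hf := by
    obtain ⟨y, hy, hyf, hyx⟩ := C.lift b _ x hx hf
    obtain ⟨z, hz, hzf, hzy⟩ := D.lift b _ y hy hyf
    exact ⟨z, hz, hzf, fun n => by simp [Hom.comp, hzy, hyx]⟩

lemma TrivialUpTo.comp {C : Cover S T} {D : Cover R S} {k : ℕ} (hC : C.TrivialUpTo k)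
    (hD : D.TrivialUpTo k) : (C.comp D).TrivialUpTo k := by
  refine ⟨fun q hq => ?_, fun b σ s hs hb => ?_⟩
  · obtain ⟨s, rfl, hs⟩ := hC.1 q hq
    obtain ⟨r, rfl, hr⟩ := hD.1 s (by rwa [← C.lvl_map])
    exact ⟨r, rfl, fun r' hr' => hr _ (hs _ hr')⟩
  · have h1 := hC.2 b (D.lower b σ) (D.map s) (by rwa [D.lvl_map]) (by rwa [D.lvl_map])
    rw [hD.2 b σ s hs hb] at h1
    exact h1

lemma TrivialUpTo.mono {C : Cover S T} {k l : ℕ} (hC : C.TrivialUpTo l) (h : k ≤ l) :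
    C.TrivialUpTo k :=
  ⟨fun q hq => hC.1 q (hq.trans h), fun b σ s hs => hC.2 b σ s (hs.trans_le h)⟩

end Cover

end GameTree

namespace GameTree

variable {T : GameTree}

lemma phased_congr {b : Bool} {U : Set T.Pos} {N : ℕ} {g g' : T.Pos → T.Pos → T.Pos}
    {h h' : T.Pos → T.Pos} {q : T.Pos} (hg : ∀ u, g u q = g' u q) (hh : h q = h' q) :
    phased b U N g h q = phased b U N g' h' q := by
  simp only [phased, hg, hh]

namespace Unravel

variable (D : Set T.Pos) (K : ℕ)

/-- The set of positions `a` is a quasi-strategy for the player `false` from level `K + 1` on. -/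
def QuasiFst (a : Set T.Pos) : Prop :=
  ∀ p ∈ a, K + 1 ≤ T.lvl p → (T.lvl p % 2 = 0 → ∃ c ∈ a, T.IsChild c p) ∧
    (T.lvl p % 2 = 1 → ∀ c, T.IsChild c p → c ∈ a)

/-- Inside the quasi-strategy `a`, the set `w` is a quasi-strategy for the player `true` which
avoids `D`, from level `K + 2` on. -/
def QuasiSnd (a w : Set T.Pos) : Prop :=
  ∀ p ∈ w, K + 2 ≤ T.lvl p → p ∈ a ∧ p ∉ D ∧
    (T.lvl p % 2 = 0 → ∀ c, T.IsChild c p → c ∈ a → c ∈ w) ∧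
    (T.lvl p % 2 = 1 → ∃ c ∈ w, T.IsChild c p)

/-- The position `q` obeys the answer `o` of the player `true` to the quasi-strategy `a`. -/
def Obeys (q : T.Pos) (a : Set T.Pos) : T.Pos ⊕ Set T.Pos → Prop
  | .inl u => u ∈ D ∧ u ∈ a ∧ K + 2 ≤ T.lvl u ∧
      ∀ m, m ≤ T.lvl q → m ≤ T.lvl u → T.anc q m = T.anc u m
  | .inr w => QuasiSnd D K a w ∧ ∀ m, K + 2 ≤ m → m ≤ T.lvl q → T.anc q m ∈ w

/-- The legal positions of the unravelled tree. -/
structure Legal (q : T.Pos) (a : Set T.Pos) (o : T.Pos ⊕ Set T.Pos) : Prop where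
  fst_eq : T.lvl q ≤ K → a = ∅
  snd_eq : T.lvl q ≤ K + 1 → o = .inr ∅
  quasi : K + 1 ≤ T.lvl q → T.anc q (K + 1) ∈ a ∧ QuasiFst K a
  obeys : K + 2 ≤ T.lvl q → Obeys D K q a o

/-- Positions of the unravelled tree: the player `false` adds a quasi-strategy at level `K`, which
is answered by the player `true` at level `K + 1`. -/
@[ext]
structure Position where
  pos : T.Pos
  fst : Set T.Pos
  snd : T.Pos ⊕ Set T.Pos
  legal : Legal D K pos fst snd

variable {D K}

lemma Obeys.of_child {q c : T.Pos} {a : Set T.Pos} {o : T.Pos ⊕ Set T.Pos} (hc : T.IsChild c q)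
    (h : Obeys D K c a o) : Obeys D K q a o := by
  have h2 := hc.2
  cases o with
  | inl u =>
    refine ⟨h.1, h.2.1, h.2.2.1, fun m hm hu => ?_⟩
    rw [← hc.anc hm]
    exact h.2.2.2 m (by omega) hu
  | inr w =>
    refine ⟨h.1, fun m hm hq => ?_⟩
    rw [← hc.anc hq]
    exact h.2 m hm (by omega)

open Classical in
lemma Legal.par {q : T.Pos} {a : Set T.Pos} {o : T.Pos ⊕ Set T.Pos} (h : Legal D K q a o) :
    Legal D K (T.par q) (if T.lvl q ≤ K + 1 then ∅ else a)
      (if T.lvl q ≤ K + 2 then .inr ∅ else o) := by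
  have hl := T.lvl_par q
  constructor
  · intro h1
    rw [if_pos (by omega)]
  · intro h1
    rw [if_pos (by omega)]
  · intro h1
    rw [if_neg (by omega), anc_par (by omega)]
    exact h.quasi (by omega)
  · intro h1
    rw [if_neg (by omega), if_neg (by omega)]
    exact (h.obeys (by omega)).of_child (isChild_par (by omega))

lemma legal_of_le {q : T.Pos} (h : T.lvl q ≤ K) : Legal D K q ∅ (.inr ∅) :=
  ⟨fun _ => rfl, fun _ => rfl, fun h1 => by omega, fun h1 => by omega⟩

lemma legal_of_eq {q : T.Pos} {a : Set T.Pos} (h : T.lvl q = K + 1) (hq : q ∈ a)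
    (ha : QuasiFst K a) : Legal D K q a (.inr ∅) :=
  ⟨fun h1 => by omega, fun _ => rfl, fun h1 => ⟨by rwa [anc_of_le h.le], ha⟩, fun h1 => by omega⟩

lemma legal_of_ge {q : T.Pos} {a : Set T.Pos} {o : T.Pos ⊕ Set T.Pos} (h : K + 2 ≤ T.lvl q)
    (hq : T.anc q (K + 1) ∈ a) (ha : QuasiFst K a) (ho : Obeys D K q a o) : Legal D K q a o :=
  ⟨fun h1 => by omega, fun h1 => by omega, fun _ => ⟨hq, ha⟩, fun _ => ho⟩

variable (D K) in
/-- The targets of the player `false` once the quasi-strategy `a` has been played. -/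
def targets (a : Set T.Pos) : Set T.Pos := {u | u ∈ D ∧ u ∈ a ∧ K + 2 ≤ T.lvl u}

lemma quasiSnd_diff {a : Set T.Pos} (ha : QuasiFst K a) :
    QuasiSnd D K a (a \ forced false (targets D K a)) := by
  intro p hp hl
  refine ⟨hp.1, fun hD => hp.2 (subset_forced _ _ ⟨hD, hp.1, hl⟩), fun h0 c hc hca => ⟨hca, ?_⟩,
    fun h1 => ?_⟩
  · exact fun hcV => hp.2 (forced_of_child h0 hc hcV)
  · by_contra! hno
    refine hp.2 (forced_of_forall_child fun c hc => ?_)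
    by_contra hcV
    exact hno c ⟨(ha p hp.1 (by omega)).2 h1 c hc, hcV⟩ hc

lemma quasiFst_compl (U : Set T.Pos) : QuasiFst K (forced true U)ᶜ := by
  intro p hp _
  refine ⟨fun _ => ?_, fun h1 c hc hcV => hp (forced_of_child h1 hc hcV)⟩
  by_contra! hno
  exact hp (forced_of_forall_child fun c hc => by_contra fun hcV => hno c hcV hc)

lemma Legal.exists_child (hK : K % 2 = 0) {q : T.Pos} {a : Set T.Pos} {o : T.Pos ⊕ Set T.Pos}
    (h : Legal D K q a o) : ∃ c a' o', T.IsChild c q ∧ Legal D K c a' o' ∧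
      (T.lvl c ≤ K + 1 → a = ∅) ∧ (¬ T.lvl c ≤ K + 1 → a = a') ∧ (T.lvl c ≤ K + 2 → o = .inr ∅) ∧
      (¬ T.lvl c ≤ K + 2 → o = o') := by
  rcases lt_trichotomy (T.lvl q) K with h1 | h1 | h1
  · obtain ⟨c, hc⟩ := T.exists_child q
    have := hc.2
    exact ⟨c, ∅, .inr ∅, hc, legal_of_le (by omega), fun _ => h.fst_eq (by omega),
      fun _ => by omega, fun _ => h.snd_eq (by omega), fun _ => by omega⟩
  · obtain ⟨c, hc⟩ := T.exists_child q
    have := hc.2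
    exact ⟨c, Set.univ, .inr ∅, hc, legal_of_eq (by omega) trivial
      fun p _ _ => ⟨fun _ => (T.exists_child p).imp fun _ h => ⟨trivial, h⟩, fun _ _ _ => trivial⟩,
      fun _ => h.fst_eq (by omega), fun _ => by omega, fun _ => h.snd_eq (by omega),
      fun _ => by omega⟩
  rcases Nat.lt_or_ge (K + 1) (T.lvl q) with h2 | h2
  · have hqa := (h.quasi (by omega)).1
    have ha := (h.quasi (by omega)).2
    have ho := h.obeys (by omega)
    obtain ⟨c, hc, hco⟩ : ∃ c, T.IsChild c q ∧ Obeys D K c a o := by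
      cases o with
      | inl u =>
        rcases Nat.lt_or_ge (T.lvl q) (T.lvl u) with h3 | h3
        · refine ⟨T.anc u (T.lvl q + 1), ?_, ho.1, ho.2.1, ho.2.2.1, fun m hm _ => ?_⟩
          · have := isChild_anc_succ h3
            rwa [← ho.2.2.2 _ le_rfl h3.le, anc_self] at this
          · rw [lvl_anc h3] at hm
            exact anc_anc hm
        · obtain ⟨c, hc⟩ := T.exists_child q
          refine ⟨c, hc, ho.1, ho.2.1, ho.2.2.1, fun m _ hu => ?_⟩
          rw [IsChild.anc hc (by omega)]
          exact ho.2.2.2 m (by omega) hu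
      | inr w =>
        have hqw : q ∈ w := by simpa [anc_self] using ho.2 _ (by omega) le_rfl
        obtain ⟨hq1, -, hq3, hq4⟩ := ho.1 q hqw (by omega)
        obtain ⟨c, hcw, hc⟩ : ∃ c ∈ w, T.IsChild c q := by
          rcases Nat.mod_two_eq_zero_or_one (T.lvl q) with h0 | h0
          · obtain ⟨c, hc, hcq⟩ := (ha q hq1 (by omega)).1 h0
            exact ⟨c, hq3 h0 c hcq hc, hcq⟩
          · exact hq4 h0
        refine ⟨c, hc, ho.1, fun m hm hmc => ?_⟩
        have := hc.2
        rcases Nat.lt_or_ge (T.lvl q) m with h3 | h3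
        · rwa [anc_of_le (by omega)]
        · rw [hc.anc h3]
          exact ho.2 m hm h3
    have := hc.2
    exact ⟨c, a, o, hc, legal_of_ge (by omega) (by rwa [hc.anc (by omega)]) ha hco,
      fun _ => by omega, fun _ => rfl, fun _ => by omega, fun _ => rfl⟩
  · have h3 : T.lvl q = K + 1 := by omega
    obtain ⟨hqa, ha⟩ := h.quasi (by omega)
    rw [anc_of_le h3.le] at hqa
    obtain ⟨c, o', hc, hco⟩ : ∃ c o', T.IsChild c q ∧ Obeys D K c a o' := by
      by_cases hV : ∀ c, T.IsChild c q → c ∈ forced false (targets D K a)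
      · obtain ⟨u, hu, hqu, hanc⟩ := exists_descendant_of_forced (forced_of_forall_child hV)
        have hu2 := hu.2.2
        refine ⟨T.anc u (T.lvl q + 1), .inl u, ?_, hu.1, hu.2.1, hu.2.2, fun m hm _ => ?_⟩
        · have := isChild_anc_succ (q := u) (m := T.lvl q) (by omega)
          rwa [hanc] at this
        · rw [lvl_anc (by omega)] at hm
          exact anc_anc hm
      · push Not at hV
        obtain ⟨c, hc, hcV⟩ := hV
        have := hc.2
        refine ⟨c, .inr (a \ forced false (targets D K a)), hc, quasiSnd_diff ha,
          fun m hm hmc => ?_⟩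
        rw [anc_of_le (by omega)]
        exact ⟨(ha q hqa (by omega)).2 (by omega) c hc, hcV⟩
    have := hc.2
    refine ⟨c, a, o', hc, legal_of_ge (by omega) ?_ ha hco, fun _ => by omega, fun _ => rfl,
      fun _ => h.snd_eq (by omega), fun _ => by omega⟩
    rwa [hc.anc (by omega), anc_of_le (by omega)]

open Classical in
/-- The unravelled tree. -/
noncomputable def tree (D : Set T.Pos) {K : ℕ} (hK : K % 2 = 0) : GameTree where
  Pos := Position D K
  lvl p := T.lvl p.pos
  par p := ⟨_, _, _, p.legal.par⟩
  lvl_par p := T.lvl_par p.pos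
  exists_child p := by
    obtain ⟨c, a', o', hc, hl, h1, h2, h3, h4⟩ := p.legal.exists_child hK
    refine ⟨⟨c, a', o', hl⟩, Position.ext hc.1 ?_ ?_, hc.2⟩
    · dsimp only
      split_ifs with h
      · exact (h1 h).symm
      · exact (h2 h).symm
    · dsimp only
      split_ifs with h
      · exact (h3 h).symm
      · exact (h4 h).symm

variable {hK : K % 2 = 0}

/-- The projection of the unravelled tree. -/
def proj (D : Set T.Pos) {K : ℕ} (hK : K % 2 = 0) : Hom (tree D hK) T where
  map p := p.pos
  lvl_map _ := rfl
  map_par _ := rfl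

lemma fst_of_isChild {c p : Position D K} (h : (tree D hK).IsChild c p) (hp : T.lvl p.pos ≠ K) :
    c.fst = p.fst := by
  have h1 : T.lvl c.pos = T.lvl p.pos + 1 := h.2
  have h2 := congrArg Position.fst h.1
  change (if T.lvl c.pos ≤ K + 1 then _ else _) = p.fst at h2
  split_ifs at h2 with h3
  · rw [← h2, c.legal.fst_eq (by omega)]
  · exact h2

lemma snd_of_isChild {c p : Position D K} (h : (tree D hK).IsChild c p)
    (hp : T.lvl p.pos ≠ K + 1) : c.snd = p.snd := by
  have h1 : T.lvl c.pos = T.lvl p.pos + 1 := h.2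
  have h2 := congrArg Position.snd h.1
  change (if T.lvl c.pos ≤ K + 2 then _ else _) = p.snd at h2
  split_ifs at h2 with h3
  · rw [← h2, c.legal.snd_eq (by omega)]
  · exact h2

lemma decided (hD : ∀ c q, T.IsChild c q → q ∈ D → c ∈ D) :
    (tree D hK).Decided ((proj D hK).pre {x | ∃ n, x n ∈ D}) := by
  refine ⟨K + 2, {p | ∃ u, p.snd = .inl u}, fun y hy => ?_⟩
  have hl : ∀ n, T.lvl (y n).pos = n := fun n => (hy n).1
  have hx : T.IsPlay fun n => (y n).pos := (proj D hK).isPlay hy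
  have hs : ∀ n, K + 2 ≤ n → (y n).snd = (y (K + 2)).snd := by
    intro n hn
    induction n, hn using Nat.le_induction with
    | base => rfl
    | succ n hn ih => rw [← ih, snd_of_isChild (hy.isChild n) (by rw [hl]; omega)]
  have ho : ∀ n, K + 2 ≤ n → Obeys D K (y n).pos (y n).fst (y (K + 2)).snd := fun n hn => by
    rw [← hs n hn]
    exact (y n).legal.obeys (by rwa [hl])
  constructor
  · rintro ⟨n, hn⟩
    change (y n).pos ∈ D at hn
    rcases ho' : (y (K + 2)).snd with u | w
    · exact ⟨u, ho'⟩
    · exfalso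
      have hup : ∀ j, (y (n + j)).pos ∈ D := by
        intro j
        induction j with
        | zero => exact hn
        | succ j ih => exact hD _ _ (hx.isChild (n + j)) ih
      have h1 := ho (n + (K + 2)) (by omega)
      rw [ho'] at h1
      have h2 := h1.2 (n + (K + 2)) (by omega) (by rw [hl])
      rw [anc_of_le (by rw [hl])] at h2
      exact (h1.1 _ h2 (by rw [hl]; omega)).2.1 (hup _)
  · rintro ⟨u, hu⟩
    have h0 := ho _ le_rfl
    rw [hu] at h0
    have h1 := ho _ h0.2.2.1
    rw [hu] at h1
    have h2 := h1.2.2.2 (T.lvl u) (by rw [hl]) le_rfl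
    rw [anc_self, anc_of_le (by rw [hl])] at h2
    refine ⟨T.lvl u, ?_⟩
    change (y (T.lvl u)).pos ∈ D
    rw [h2]
    exact h0.1

end Unravel

end GameTree

namespace GameTree
namespace Unravel

variable {T : GameTree} {D : Set T.Pos} {K : ℕ} {hK : K % 2 = 0}

open Classical in
/-- The move of `σ` at the position `(q, a, o)` of the unravelled tree. -/
noncomputable def sim (σ : (tree D hK).Strat) (q : T.Pos) (a : Set T.Pos)
    (o : T.Pos ⊕ Set T.Pos) : T.Pos :=
  if h : Legal D K q a o then (σ.move ⟨q, a, o, h⟩ : Position D K).pos else someChild q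

open Classical in
/-- The quasi-strategy offered by `σ` at `q`. -/
noncomputable def offer (σ : (tree D hK).Strat) (q : T.Pos) : Set T.Pos :=
  if h : Legal D K q ∅ (.inr ∅) then (σ.move ⟨q, _, _, h⟩ : Position D K).fst else ∅

open Classical in
/-- The answer of `σ` to the quasi-strategy `a` at `q`. -/
noncomputable def answer (σ : (tree D hK).Strat) (q : T.Pos) (a : Set T.Pos) :
    T.Pos ⊕ Set T.Pos :=
  if h : Legal D K q a (.inr ∅) then (σ.move ⟨q, _, _, h⟩ : Position D K).snd else .inr ∅

lemma isChild_sim (σ : (tree D hK).Strat) (q : T.Pos) (a : Set T.Pos) (o : T.Pos ⊕ Set T.Pos) :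
    T.IsChild (sim σ q a o) q := by
  unfold sim
  split_ifs with h
  · exact (proj D hK).isChild (σ.isChild ⟨q, a, o, h⟩)
  · exact isChild_someChild q

/-- The positions chosen by `σ` in answer to some quasi-strategy played at `q`. -/
def answers (σ : (tree D hK).Strat) (q : T.Pos) : Set T.Pos := {u | ∃ a, answer σ q a = .inl u}

open Classical in
/-- A quasi-strategy to which `σ` answers by `u`. -/
noncomputable def query (σ : (tree D hK).Strat) (q u : T.Pos) : Set T.Pos :=
  Classical.epsilon fun a => answer σ q a = .inl u

open Classical in
/-- The translation of a strategy of the player `false`. -/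
noncomputable def lowerFst (σ : (tree D hK).Strat) (q : T.Pos) : T.Pos :=
  if T.lvl q ≤ K then sim σ q ∅ (.inr ∅) else
    phased false (targets D K (offer σ (T.anc q K))) (K + 2)
      (fun u q => sim σ q (offer σ (T.anc q K)) (.inl u))
      (fun q => sim σ q (offer σ (T.anc q K)) (.inr (offer σ (T.anc q K) \
        forced false (targets D K (offer σ (T.anc q K)))))) q

open Classical in
/-- The translation of a strategy of the player `true`. -/
noncomputable def lowerSnd (σ : (tree D hK).Strat) (q : T.Pos) : T.Pos :=
  if T.lvl q ≤ K then sim σ q ∅ (.inr ∅) else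
    phased true (answers σ (T.anc q (K + 1))) (K + 1)
      (fun u q => sim σ q (query σ (T.anc q (K + 1)) u)
        (if T.lvl q = K + 1 then .inr ∅ else .inl u))
      (fun q => sim σ q (forced true (answers σ (T.anc q (K + 1))))ᶜ
        (if T.lvl q = K + 1 then .inr ∅ else
          answer σ (T.anc q (K + 1)) (forced true (answers σ (T.anc q (K + 1))))ᶜ)) q

lemma isChild_lowerFst (σ : (tree D hK).Strat) (q : T.Pos) : T.IsChild (lowerFst σ q) q := by
  unfold lowerFst
  split_ifs
  · exact isChild_sim _ _ _ _
  · exact isChild_phased (fun _ _ => isChild_sim _ _ _ _) (fun _ => isChild_sim _ _ _ _) q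

lemma isChild_lowerSnd (σ : (tree D hK).Strat) (q : T.Pos) : T.IsChild (lowerSnd σ q) q := by
  unfold lowerSnd
  split_ifs
  · exact isChild_sim _ _ _ _
  · exact isChild_phased (fun _ _ => isChild_sim _ _ _ _) (fun _ => isChild_sim _ _ _ _) q

section causal

variable {σ σ' : (tree D hK).Strat} {q : T.Pos}

lemma sim_congr (h : ∀ p : Position D K, T.lvl p.pos = T.lvl q → σ.move p = σ'.move p)
    (a : Set T.Pos) (o : T.Pos ⊕ Set T.Pos) : sim σ q a o = sim σ' q a o := by
  unfold sim
  split_ifs with hl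
  · rw [h ⟨q, a, o, hl⟩ rfl]
  · rfl

lemma offer_congr (h : ∀ p : Position D K, T.lvl p.pos = T.lvl q → σ.move p = σ'.move p) :
    offer σ q = offer σ' q := by
  unfold offer
  split_ifs with hl
  · rw [h ⟨q, _, _, hl⟩ rfl]
  · rfl

lemma answer_congr (h : ∀ p : Position D K, T.lvl p.pos = T.lvl q → σ.move p = σ'.move p) :
    answer σ q = answer σ' q := by
  funext a
  unfold answer
  split_ifs with hl
  · rw [h ⟨q, _, _, hl⟩ rfl]
  · rfl

lemma lowerFst_congr (h : ∀ p : Position D K, T.lvl p.pos ≤ T.lvl q → T.lvl p.pos % 2 = 0 →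
    σ.move p = σ'.move p) (hq : T.lvl q % 2 = 0) : lowerFst σ q = lowerFst σ' q := by
  have h1 := sim_congr (σ := σ) (σ' := σ') (q := q) fun p hp => h p hp.le (by omega)
  unfold lowerFst
  split_ifs with h2
  · exact h1 _ _
  · have h3 : offer σ (T.anc q K) = offer σ' (T.anc q K) := by
      apply offer_congr
      rw [lvl_anc (by omega)]
      exact fun p hp => h p (by omega) (by omega)
    rw [h3]
    exact phased_congr (fun u => by rw [h1, h3]) (by rw [h1, h3])

lemma lowerSnd_congr (h : ∀ p : Position D K, T.lvl p.pos ≤ T.lvl q → T.lvl p.pos % 2 = 1 →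
    σ.move p = σ'.move p) (hq : T.lvl q % 2 = 1) : lowerSnd σ q = lowerSnd σ' q := by
  have h1 := sim_congr (σ := σ) (σ' := σ') (q := q) fun p hp => h p hp.le (by omega)
  unfold lowerSnd
  split_ifs with h2
  · exact h1 _ _
  · have h3 : answer σ (T.anc q (K + 1)) = answer σ' (T.anc q (K + 1)) := by
      apply answer_congr
      rw [lvl_anc (by omega)]
      exact fun p hp => h p (by omega) (by omega)
    have h4 : answers σ (T.anc q (K + 1)) = answers σ' (T.anc q (K + 1)) := by
      simp only [answers, h3]
    rw [h4]
    exact phased_congr (fun u => by simp only [h1, query, h3]) (by simp only [h1, h3, h4])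

end causal

open Classical in
/-- Lifting a play to the unravelled tree. -/
lemma exists_lift {x : ℕ → T.Pos} (hx : T.IsPlay x) {a : Set T.Pos} {o : T.Pos ⊕ Set T.Pos}
    (ha : QuasiFst K a) (hxa : x (K + 1) ∈ a) (ho : ∀ n, K + 2 ≤ n → Obeys D K (x n) a o)
    {b : Bool} {σ : (tree D hK).Strat}
    (h1 : ∀ n, n ≤ K → n % 2 = b.toNat → x (n + 1) = sim σ (x n) ∅ (.inr ∅))
    (h2 : K % 2 = b.toNat → offer σ (x K) = a)
    (h3 : (K + 1) % 2 = b.toNat → x (K + 2) = sim σ (x (K + 1)) a (.inr ∅))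
    (h4 : (K + 1) % 2 = b.toNat → answer σ (x (K + 1)) a = o)
    (h5 : ∀ n, K + 2 ≤ n → n % 2 = b.toNat → x (n + 1) = sim σ (x n) a o) :
    ∃ y, (tree D hK).IsPlay y ∧ FollowsFrom 0 b σ.move y ∧ ∀ n, (proj D hK).map (y n) = x n := by
  have hl : ∀ n, T.lvl (x n) = n := fun n => (hx n).1
  have hlegal : ∀ n, Legal D K (x n) (if n ≤ K then ∅ else a)
      (if n ≤ K + 1 then .inr ∅ else o) := by
    intro n
    split_ifs with h6 h7 h7
    · exact legal_of_le (by rwa [hl])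
    · omega
    · obtain rfl : n = K + 1 := by omega
      exact legal_of_eq (by rw [hl]) hxa ha
    · exact legal_of_ge (by rw [hl]; omega) (by rwa [hx.anc (by omega)]) ha (ho n (by omega))
  let y : ℕ → Position D K := fun n => ⟨_, _, _, hlegal n⟩
  have hy : (tree D hK).IsPlay y := by
    refine fun n => ⟨hl n, Position.ext (hx n).2 ?_ ?_⟩
    · change (if T.lvl (x (n + 1)) ≤ K + 1 then ∅ else if n + 1 ≤ K then ∅ else a) =
        if n ≤ K then ∅ else a
      rw [hl]
      split_ifs <;> first | rfl | omega
    · change (if T.lvl (x (n + 1)) ≤ K + 2 then .inr ∅ else if n + 1 ≤ K + 1 then .inr ∅ else o) =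
        if n ≤ K + 1 then .inr ∅ else o
      rw [hl]
      split_ifs <;> first | rfl | omega
  refine ⟨y, hy, fun n _ hb => ?_, fun _ => rfl⟩
  have hc := σ.isChild (y n)
  have hsim : x (n + 1) = sim σ (x n) (if n ≤ K then ∅ else a)
      (if n ≤ K + 1 then .inr ∅ else o) := by
    split_ifs with h6 h7 h7
    · exact h1 n h6 hb
    · omega
    · obtain rfl : n = K + 1 := by omega
      exact h3 hb
    · exact h5 n (by omega) hb
  refine Position.ext ?_ ?_ ?_
  · rw [sim, dif_pos (hlegal n)] at hsim
    exact hsim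
  · by_cases h6 : n = K
    · subst h6
      have h7 := h2 hb
      rw [offer, dif_pos (legal_of_le (hl n).le)] at h7
      have h8 : y n = ⟨x n, ∅, .inr ∅, legal_of_le (hl n).le⟩ :=
        Position.ext rfl (if_pos le_rfl) (if_pos (by omega))
      rw [h8, h7]
      exact if_neg (by omega)
    · rw [fst_of_isChild (hy.isChild n) (by rw [hl n]; exact h6),
        fst_of_isChild hc (by rw [hl n]; exact h6)]
  · by_cases h6 : n = K + 1
    · subst h6
      have h7 := h4 hb
      have hle := legal_of_eq (D := D) (hl (K + 1)) hxa ha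
      rw [answer, dif_pos hle] at h7
      have h8 : y (K + 1) = ⟨x (K + 1), a, .inr ∅, hle⟩ :=
        Position.ext rfl (if_neg (by omega)) (if_pos le_rfl)
      rw [h8, h7]
      exact if_neg (by omega)
    · rw [snd_of_isChild (hy.isChild n) (by rw [hl n]; exact h6),
        snd_of_isChild hc (by rw [hl n]; exact h6)]

lemma obeys_inl {x : ℕ → T.Pos} (hx : T.IsPlay x) {a : Set T.Pos} {k : ℕ} (hk : K + 2 ≤ k)
    (hD : x k ∈ D) (ha : x k ∈ a) (n : ℕ) : Obeys D K (x n) a (.inl (x k)) := by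
  refine ⟨hD, ha, by rwa [(hx k).1], fun m hm hu => ?_⟩
  rw [(hx _).1] at hm hu
  rw [hx.anc hm, hx.anc hu]

/-- On the way to the position chosen by the player `true`, all moves are forced. -/
lemma sim_inl (σ : (tree D hK).Strat) {x : ℕ → T.Pos} (hx : T.IsPlay x) {a : Set T.Pos} {k : ℕ}
    (ha : QuasiFst K a) (hxa : x (K + 1) ∈ a) (hk : K + 2 ≤ k) (hD : x k ∈ D) (hka : x k ∈ a)
    {n : ℕ} (hn : K + 2 ≤ n) (hnk : n < k) : x (n + 1) = sim σ (x n) a (.inl (x k)) := by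
  have hl : ∀ n, T.lvl (x n) = n := fun n => (hx n).1
  have hle : Legal D K (x n) a (.inl (x k)) :=
    legal_of_ge (by rwa [hl]) (by rwa [hx.anc (by omega)]) ha (obeys_inl hx hk hD hka n)
  rw [sim, dif_pos hle]
  set c : Position D K := σ.move ⟨_, _, _, hle⟩ with hcdef
  have hc := σ.isChild ⟨_, _, _, hle⟩
  have h1 : T.lvl c.pos = n + 1 := (hc.2).trans (congrArg (· + 1) (hl n))
  have h2 : c.fst = a := fst_of_isChild hc (by rw [hl]; omega)
  have h3 : c.snd = .inl (x k) := snd_of_isChild hc (by rw [hl]; omega)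
  have h4 := c.legal.obeys (by omega)
  rw [h2, h3] at h4
  have h5 := h4.2.2.2 (n + 1) h1.ge (by rw [hl]; omega)
  rw [anc_of_le h1.le, hx.anc (by omega)] at h5
  exact h5.symm

lemma sim_inr_mem (σ : (tree D hK).Strat) {q : T.Pos} {a w : Set T.Pos}
    (h : Legal D K q a (.inr w)) (hq : K + 2 ≤ T.lvl q) : sim σ q a (.inr w) ∈ w := by
  rw [sim, dif_pos h]
  set c : Position D K := σ.move ⟨_, _, _, h⟩ with hcdef
  have hc := σ.isChild ⟨_, _, _, h⟩
  have h1 : T.lvl c.pos = T.lvl q + 1 := hc.2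
  have h2 : c.fst = a := fst_of_isChild hc (by dsimp only; omega)
  have h3 : c.snd = .inr w := snd_of_isChild hc (by dsimp only; omega)
  have h4 := c.legal.obeys (by omega)
  rw [h2, h3] at h4
  simpa [anc_self] using h4.2 (T.lvl c.pos) (by omega) le_rfl

lemma lift_fst (σ : (tree D hK).Strat) {x : ℕ → T.Pos} (hx : T.IsPlay x)
    (hf : FollowsFrom 0 false (lowerFst σ) x) :
    ∃ y, (tree D hK).IsPlay y ∧ FollowsFrom 0 false σ.move y ∧
      ∀ n, (proj D hK).map (y n) = x n := by
  have hl : ∀ n, T.lvl (x n) = n := fun n => (hx n).1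
  have h1 : ∀ n, n ≤ K → n % 2 = false.toNat → x (n + 1) = sim σ (x n) ∅ (.inr ∅) := by
    intro n hn hb
    rw [hf n n.zero_le hb, lowerFst, if_pos (by rwa [hl])]
  set a := offer σ (x K) with hadef
  obtain ⟨hxa, ha⟩ : x (K + 1) ∈ a ∧ QuasiFst K a := by
    have hle : Legal D K (x K) ∅ (.inr ∅) := legal_of_le (hl K).le
    have h2 := h1 K le_rfl hK
    rw [offer, dif_pos hle] at hadef
    rw [sim, dif_pos hle] at h2
    set c : Position D K := σ.move ⟨_, _, _, hle⟩ with hcdef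
    have h3 := c.legal.quasi (by rw [← h2, hl])
    rwa [← hadef, anc_of_le (by rw [← h2, hl]), ← h2] at h3
  have hph : FollowsFrom (K + 2) false (phased false (targets D K a) (K + 2)
      (fun u q => sim σ q a (.inl u))
      (fun q => sim σ q a (.inr (a \ forced false (targets D K a))))) x := by
    intro n hn hb
    have hanc : T.anc (x n) K = x K := hx.anc (by omega)
    rw [hf n n.zero_le hb, lowerFst, if_neg (by rw [hl]; omega)]
    simp only [hanc]
    exact phased_congr (fun u => by rw [hanc]) (by rw [hanc])
  rcases hph.phased_cases (fun u hu => hu.2.2) hx with ⟨hno, hfol⟩ | ⟨k, hk, hxk, hfol⟩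
  · have hmem : ∀ n, K + 2 ≤ n → ∀ m, K + 2 ≤ m → m ≤ n →
        x m ∈ a \ forced false (targets D K a) := by
      intro n hn
      induction n, hn using Nat.le_induction with
      | base =>
        intro m hm1 hm2
        obtain rfl : m = K + 2 := by omega
        exact ⟨(ha _ hxa (by rw [hl])).2 (by rw [hl]; omega) _ (hx.isChild _), hno _ le_rfl⟩
      | succ n hn ih =>
        intro m hm1 hm2
        rcases Nat.lt_or_ge n m with h2 | h2
        · obtain rfl : m = n + 1 := by omega
          rcases Nat.mod_two_eq_zero_or_one n with h0 | h0
          · rw [hfol n hn h0]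
            refine sim_inr_mem σ (legal_of_ge (by rwa [hl]) (by rwa [hx.anc (by omega)]) ha
              ⟨quasiSnd_diff ha, fun j hj1 hj2 => ?_⟩) (by rwa [hl])
            rw [hl] at hj2
            rw [hx.anc hj2]
            exact ih j hj1 hj2
          · exact ⟨(ha _ (ih n hn le_rfl).1 (by rw [hl]; omega)).2 (by rwa [hl]) _ (hx.isChild _),
              hno _ hm1⟩
        · exact ih m hm1 h2
    refine exists_lift hx ha hxa (o := .inr (a \ forced false (targets D K a))) ?_ h1
      (fun _ => rfl) (fun h => by simp at h; omega) (fun h => by simp at h; omega) hfol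
    refine fun n hn => ⟨quasiSnd_diff ha, fun m hm1 hm2 => ?_⟩
    rw [hl] at hm2
    rw [hx.anc hm2]
    exact hmem n hn m hm1 hm2
  · refine exists_lift hx ha hxa (o := .inl (x k)) (fun n _ => obeys_inl hx hk hxk.1 hxk.2.1 n) h1
      (fun _ => rfl) (fun h => by simp at h; omega) (fun h => by simp at h; omega) fun n hn hb => ?_
    rcases Nat.lt_or_ge n k with h2 | h2
    · exact sim_inl σ hx ha hxa hk hxk.1 hxk.2.1 hn h2
    · exact hfol n h2 hb

lemma obeys_of_answer {σ : (tree D hK).Strat} {q : T.Pos} (hq : T.lvl q = K + 1) {a : Set T.Pos}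
    (ha : QuasiFst K a) (hqa : q ∈ a) :
    Obeys D K (sim σ q a (.inr ∅)) a (answer σ q a) := by
  have hle := legal_of_eq (D := D) hq hqa ha
  rw [sim, answer, dif_pos hle, dif_pos hle]
  set c : Position D K := σ.move ⟨_, _, _, hle⟩ with hcdef
  have hc := σ.isChild ⟨_, _, _, hle⟩
  have h1 : T.lvl c.pos = T.lvl q + 1 := hc.2
  have h2 : c.fst = a := fst_of_isChild hc (by dsimp only; omega)
  have h3 := c.legal.obeys (by omega)
  rwa [h2] at h3

lemma quasi_of_answer_eq_inl {σ : (tree D hK).Strat} {q : T.Pos} (hq : T.lvl q = K + 1)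
    {a : Set T.Pos} {u : T.Pos} (h : answer σ q a = .inl u) : q ∈ a ∧ QuasiFst K a := by
  unfold answer at h
  split_ifs at h with hle
  have := hle.quasi hq.ge
  rwa [anc_of_le hq.le] at this

lemma lift_snd (σ : (tree D hK).Strat) {x : ℕ → T.Pos} (hx : T.IsPlay x)
    (hf : FollowsFrom 0 true (lowerSnd σ) x) :
    ∃ y, (tree D hK).IsPlay y ∧ FollowsFrom 0 true σ.move y ∧
      ∀ n, (proj D hK).map (y n) = x n := by
  have hl : ∀ n, T.lvl (x n) = n := fun n => (hx n).1
  have h1 : ∀ n, n ≤ K → n % 2 = true.toNat → x (n + 1) = sim σ (x n) ∅ (.inr ∅) := by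
    intro n hn hb
    rw [hf n n.zero_le hb, lowerSnd, if_pos (by rwa [hl])]
  set q := x (K + 1) with hqdef
  have hq : T.lvl q = K + 1 := hl _
  have hph : FollowsFrom (K + 1) true (phased true (answers σ q) (K + 1)
      (fun u p => sim σ p (query σ q u) (if T.lvl p = K + 1 then .inr ∅ else .inl u))
      (fun p => sim σ p (forced true (answers σ q))ᶜ
        (if T.lvl p = K + 1 then .inr ∅ else answer σ q (forced true (answers σ q))ᶜ))) x := by
    intro n hn hb
    have hanc : T.anc (x n) (K + 1) = q := hx.anc hn
    rw [hf n n.zero_le hb, lowerSnd, if_neg (by rw [hl]; omega), hanc]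
    exact phased_congr (fun u => by rw [hanc]) (by rw [hanc])
  have hans : ∀ u ∈ answers σ q, answer σ q (query σ q u) = .inl u := fun u hu =>
    Classical.epsilon_spec hu
  have hU : ∀ u ∈ answers σ q, u ∈ D ∧ u ∈ query σ q u ∧ K + 2 ≤ T.lvl u ∧
      ∀ m, m ≤ T.lvl (sim σ q (query σ q u) (.inr ∅)) → m ≤ T.lvl u →
        T.anc (sim σ q (query σ q u) (.inr ∅)) m = T.anc u m := by
    intro u hu
    have h2 := quasi_of_answer_eq_inl hq (hans u hu)
    have h3 := obeys_of_answer (σ := σ) hq h2.2 h2.1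
    rwa [hans u hu] at h3
  rcases hph.phased_cases (fun u hu => by have := (hU u hu).2.2.1; omega) hx with
    ⟨hno, hfol⟩ | ⟨k, -, hxk, hfol⟩
  · set a := (forced true (answers σ q))ᶜ with hadef
    have ha : QuasiFst K a := quasiFst_compl _
    have hxa : x (K + 1) ∈ a := hno _ le_rfl
    have h2 : x (K + 2) = sim σ q a (.inr ∅) := by
      refine (hfol (K + 1) le_rfl (by simp; omega)).trans ?_
      dsimp only
      rw [if_pos (hl _)]
    have h3 := obeys_of_answer (σ := σ) hq ha hxa
    rw [← h2] at h3
    cases hans' : answer σ q a with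
    | inl u =>
      rw [hans'] at h3
      exact absurd (subset_forced true (answers σ q) ⟨a, hans'⟩) h3.2.1
    | inr w =>
      rw [hans'] at h3
      have hfol' : ∀ n, K + 2 ≤ n → n % 2 = true.toNat → x (n + 1) = sim σ (x n) a (.inr w) := by
        intro n hn hb
        refine (hfol n (by omega) hb).trans ?_
        dsimp only
        rw [if_neg (by rw [hl]; omega), hans']
      have ho : ∀ n, K + 2 ≤ n → Obeys D K (x n) a (.inr w) := by
        intro n hn
        induction n, hn using Nat.le_induction with
        | base => exact h3
        | succ n hn ih =>
          refine ⟨h3.1, fun m hm1 hm2 => ?_⟩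
          rw [hl] at hm2
          rcases Nat.lt_or_ge n m with h4 | h4
          · obtain rfl : m = n + 1 := by omega
            rw [anc_of_le (by rw [hl])]
            rcases Nat.mod_two_eq_zero_or_one n with h0 | h0
            · have hn' : x n ∈ w := by
                simpa [anc_of_le (hl n).le] using ih.2 n hn (by rw [hl])
              exact (h3.1 _ hn' (by rwa [hl])).2.2.1 (by rwa [hl]) _ (hx.isChild n)
                (hno _ (by omega))
            · rw [hfol' n hn h0]
              exact sim_inr_mem σ (legal_of_ge (by rwa [hl]) (by rwa [hx.anc (by omega)]) ha ih)
                (by rwa [hl])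
          · have := ih.2 m hm1 (by rwa [hl])
            rw [hx.anc h4] at this
            rwa [hx.anc hm2]
      exact exists_lift hx ha hxa ho h1 (fun h => by simp at h; omega) (fun _ => h2)
        (fun _ => hans') hfol'
  · obtain ⟨hD, hua, huk, hanc⟩ := hU _ hxk
    obtain ⟨hxa, ha⟩ := quasi_of_answer_eq_inl hq (hans _ hxk)
    rw [hl] at huk
    have h2 : x (K + 2) = sim σ q (query σ q (x k)) (.inr ∅) := by
      have h3 : T.lvl (sim σ q (query σ q (x k)) (.inr ∅)) = K + 2 := by
        rw [(isChild_sim σ q _ _).2, hq]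
      have h4 := hanc (K + 2) h3.ge (by rwa [hl])
      rw [anc_of_le h3.le, hx.anc huk] at h4
      exact h4.symm
    refine exists_lift hx ha hxa (fun n _ => obeys_inl hx huk hD hua n) h1
      (fun h => by simp at h; omega) (fun _ => h2) (fun _ => hans _ hxk) fun n hn hb => ?_
    rcases Nat.lt_or_ge n k with h3 | h3
    · exact sim_inl σ hx ha hxa huk hD hua hn h3
    · refine (hfol n h3 hb).trans ?_
      dsimp only
      rw [if_neg (by rw [hl]; omega)]

/-- The unravelled tree covers the given one. -/
noncomputable def cover (D : Set T.Pos) {K : ℕ} (hK : K % 2 = 0) : Cover (tree D hK) T where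
  toHom := proj D hK
  lower b σ := match b with
    | false => ⟨lowerFst σ, isChild_lowerFst σ⟩
    | true => ⟨lowerSnd σ, isChild_lowerSnd σ⟩
  causal b _ _ _ h hq := match b with
    | false => lowerFst_congr h hq
    | true => lowerSnd_congr h hq
  lift b σ _ hx hf := match b with
    | false => lift_fst σ hx hf
    | true => lift_snd σ hx hf

lemma trivialUpTo_cover (D : Set T.Pos) {K : ℕ} (hK : K % 2 = 0) :
    (cover D hK).TrivialUpTo K := by
  refine ⟨fun q hq => ⟨(⟨q, _, _, legal_of_le hq⟩ : Position D K), rfl, ?_⟩, fun b σ s hs hb => ?_⟩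
  · rintro ⟨q', a, o, hl⟩ rfl
    exact Position.ext rfl (hl.fst_eq hq) (hl.snd_eq (Nat.le_succ_of_le hq))
  · obtain ⟨q, a, o, hl⟩ := s
    change T.lvl q < K at hs
    obtain rfl := hl.fst_eq hs.le
    obtain rfl := hl.snd_eq (by omega)
    have h : sim σ q ∅ (.inr ∅) = (σ.move ⟨q, _, _, hl⟩ : Position D K).pos := by
      rw [sim, dif_pos hl]
    cases b
    · exact (if_pos hs.le).trans h
    · exact (if_pos hs.le).trans h

end Unravel

/-- Open sets of plays can be unravelled. -/
lemma exists_cover_of_isOpen {T : GameTree} {D : Set T.Pos}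
    (hD : ∀ c q, T.IsChild c q → q ∈ D → c ∈ D) (k : ℕ) :
    ∃ (S : GameTree) (C : Cover S T), C.TrivialUpTo k ∧ S.Decided (C.pre {x | ∃ n, x n ∈ D}) :=
  ⟨_, Unravel.cover D (K := 2 * k) (by omega),
    (Unravel.trivialUpTo_cover D _).mono (by omega), Unravel.decided hD⟩

end GameTree

namespace GameTree

namespace Limit

/-- The points of the inverse limit of a sequence of trees. -/
def Thread (S : ℕ → GameTree) (C : ∀ i, Cover (S (i + 1)) (S i)) : Type :=
  {t : ∀ i, (S i).Pos // ∀ i, (C i).map (t (i + 1)) = t i}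

variable {S : ℕ → GameTree} {C : ∀ i, Cover (S (i + 1)) (S i)} {k : ℕ}

lemma lvl_thread (t : Thread S C) (i : ℕ) : (S i).lvl (t.1 i) = (S 0).lvl (t.1 0) := by
  induction i with
  | zero => rfl
  | succ i ih => rw [← ih, ← t.2 i, (C i).lvl_map]

lemma eq_of_map_eq {T R : GameTree} {D : Cover R T} {k : ℕ} (hD : D.TrivialUpTo k) {s s' : R.Pos}
    (hs : R.lvl s ≤ k) (h : D.map s = D.map s') : s = s' :=
  (hD.1 (D.map s) (by rwa [D.lvl_map])).unique rfl h.symm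

lemma exists_thread (i : ℕ) : ∀ (S : ℕ → GameTree) (C : ∀ i, Cover (S (i + 1)) (S i)) (k : ℕ),
    (∀ i, (C i).TrivialUpTo (k + i)) → ∀ q : (S i).Pos, (S i).lvl q ≤ k + i →
    ∃ t : Thread S C, t.1 i = q := by
  induction i with
  | zero =>
    intro S C k hC q hq
    have hstep : ∀ j (p : {p : (S j).Pos // (S j).lvl p ≤ k}),
        ∃ p' : {p : (S (j + 1)).Pos // (S (j + 1)).lvl p ≤ k}, (C j).map p'.1 = p.1 := by
      intro j p
      obtain ⟨s, hs, -⟩ := (hC j).1 p.1 (p.2.trans (by omega))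
      exact ⟨⟨s, by rw [← (C j).lvl_map, hs]; exact p.2⟩, hs⟩
    choose f hf using hstep
    let t : ∀ j, {p : (S j).Pos // (S j).lvl p ≤ k} := fun j => Nat.rec ⟨q, hq⟩ f j
    exact ⟨⟨fun j => (t j).1, fun j => hf j (t j)⟩, rfl⟩
  | succ i ih =>
    intro S C k hC q hq
    obtain ⟨t, ht⟩ := ih (fun j => S (j + 1)) (fun j => C (j + 1)) (k + 1)
      (fun j => (hC (j + 1)).mono (by omega)) q (hq.trans (by omega))
    refine ⟨⟨fun j => Nat.casesOn j ((C 0).map (t.1 0)) t.1, fun j => ?_⟩, ht⟩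
    cases j with
    | zero => rfl
    | succ j => exact t.2 j

lemma thread_eq_of_le {t t' : Thread S C} {i j : ℕ} (hij : j ≤ i) (h : t.1 i = t'.1 i) :
    t.1 j = t'.1 j := by
  induction i, hij using Nat.le_induction with
  | base => exact h
  | succ i _ ih => exact ih (by rw [← t.2, ← t'.2, h])

lemma thread_ext (hC : ∀ i, (C i).TrivialUpTo (k + i)) {t t' : Thread S C} {i : ℕ}
    (hi : (S i).lvl (t.1 i) ≤ k + i) (h : t.1 i = t'.1 i) : t = t' := by
  apply Subtype.ext
  funext j
  rcases le_total i j with hij | hij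
  · induction j, hij using Nat.le_induction with
    | base => exact h
    | succ j hj ih =>
      refine eq_of_map_eq (hC j) ?_ (by rw [t.2, t'.2, ih])
      rw [lvl_thread] at hi ⊢
      omega
  · exact thread_eq_of_le hij h

/-- The inverse limit of a sequence of trees. -/
def tree (hC : ∀ i, (C i).TrivialUpTo (k + i)) : GameTree where
  Pos := Thread S C
  lvl t := (S 0).lvl (t.1 0)
  par t := ⟨fun i => (S i).par (t.1 i), fun i => by rw [(C i).map_par, t.2]⟩
  lvl_par t := (S 0).lvl_par _
  exists_child t := by
    set l := (S 0).lvl (t.1 0) with hl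
    obtain ⟨c, hc, hcl⟩ := (S (l + 1)).exists_child (t.1 (l + 1))
    rw [lvl_thread, ← hl] at hcl
    obtain ⟨u, hu⟩ := exists_thread (l + 1) S C k hC c (by omega)
    refine ⟨u, thread_ext hC (i := l + 1) ?_ ?_, ?_⟩
    · change (S (l + 1)).lvl ((S (l + 1)).par (u.1 (l + 1))) ≤ _
      rw [(S (l + 1)).lvl_par, hu, hcl]
      omega
    · change (S (l + 1)).par (u.1 (l + 1)) = _
      rw [hu, hc]
    · exact (lvl_thread u (l + 1)).symm.trans (by rw [hu, hcl])

variable (hC : ∀ i, (C i).TrivialUpTo (k + i))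

/-- The projections of the inverse limit. -/
def proj (i : ℕ) : Hom (tree hC) (S i) where
  map t := t.1 i
  lvl_map t := lvl_thread t i
  map_par _ := rfl

open Classical in
/-- The part of a strategy of the inverse limit which is visible at stage `i`. -/
noncomputable def stage (σ : (tree hC).Strat) (i : ℕ) : (S i).Strat where
  move q := if h : ∃ t : Thread S C, t.1 i = q ∧ (S i).lvl q < k + i then
    (proj hC i).map (σ.move h.choose) else someChild q
  isChild q := by
    split_ifs with h
    · have := (proj hC i).isChild (σ.isChild h.choose)
      rwa [show (proj hC i).map h.choose = q from h.choose_spec.1] at this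
    · exact isChild_someChild q

variable {hC}

open Classical in
lemma stage_move (σ : (tree hC).Strat) {i : ℕ} {t : Thread S C} (h : (S i).lvl (t.1 i) < k + i) :
    (stage hC σ i).move (t.1 i) = (proj hC i).map (σ.move t) := by
  have hex : ∃ u : Thread S C, u.1 i = t.1 i ∧ (S i).lvl (t.1 i) < k + i := ⟨t, rfl, h⟩
  have h1 : hex.choose = t :=
    thread_ext hC (by rw [hex.choose_spec.1]; exact h.le) hex.choose_spec.1
  change (if h : _ then _ else _) = _
  rw [dif_pos hex, h1]

/-- Lowering `d` times the stages of a strategy of the inverse limit. -/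
noncomputable def tau (b : Bool) (σ : (tree hC).Strat) : ℕ → ∀ i, (S i).Strat
  | 0, i => stage hC σ i
  | d + 1, i => (C i).lower b (tau b σ d (i + 1))

lemma tau_succ {b : Bool} {σ : (tree hC).Strat} (d : ℕ) : ∀ (i : ℕ) (q : (S i).Pos),
    (S i).lvl q < k + i + d → (S i).lvl q % 2 = b.toNat →
    (tau b σ (d + 1) i).move q = (tau b σ d i).move q := by
  induction d with
  | zero =>
    intro i q hq hb
    obtain ⟨t, rfl⟩ := exists_thread i S C k hC q (by omega)
    change ((C i).lower b (stage hC σ (i + 1))).move (t.1 i) = (stage hC σ i).move (t.1 i)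
    have hl : (S (i + 1)).lvl (t.1 (i + 1)) = (S i).lvl (t.1 i) :=
      (lvl_thread t (i + 1)).trans (lvl_thread t i).symm
    have h1 := (hC i).2 b (stage hC σ (i + 1)) (t.1 (i + 1)) (by omega) (by omega)
    rw [t.2, stage_move σ (by omega)] at h1
    rw [h1, stage_move σ (by omega)]
    exact (σ.move t).2 i
  | succ d ih =>
    intro i q hq hb
    exact (C i).causal b _ _ q (fun s hs hsb => ih (i + 1) s (by omega) hsb) hb

lemma tau_of_le {b : Bool} {σ : (tree hC).Strat} {d e : ℕ} (h : d ≤ e) {i : ℕ} {q : (S i).Pos}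
    (hq : (S i).lvl q < k + i + d) (hb : (S i).lvl q % 2 = b.toNat) :
    (tau b σ e i).move q = (tau b σ d i).move q := by
  induction e, h using Nat.le_induction with
  | base => rfl
  | succ e he ih => rw [tau_succ e i q (by omega) hb, ih]

open Classical in
lemma tau_congr {b : Bool} {σ σ' : (tree hC).Strat} {l : ℕ}
    (h : ∀ s, (tree hC).lvl s ≤ l → (tree hC).lvl s % 2 = b.toNat → σ.move s = σ'.move s) (d : ℕ) :
    ∀ (i : ℕ) (q : (S i).Pos), (S i).lvl q ≤ l → (S i).lvl q % 2 = b.toNat →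
      (tau b σ d i).move q = (tau b σ' d i).move q := by
  induction d with
  | zero =>
    intro i q hq hb
    change (if h : _ then _ else _) = if h : _ then _ else _
    split_ifs with hex
    · have h1 : (tree hC).lvl hex.choose = (S i).lvl q :=
        (lvl_thread _ i).symm.trans (congrArg (S i).lvl hex.choose_spec.1)
      exact congrArg (proj hC i).map (h _ (h1.trans_le hq) ((congrArg (· % 2) h1).trans hb))
    · rfl
  | succ d ih =>
    intro i q hq hb
    exact (C i).causal b _ _ q (fun s hs hsb => ih (i + 1) s (hs.trans hq) hsb) hb

/-- The strategies induced by a strategy of the inverse limit. -/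
noncomputable def lower (b : Bool) (σ : (tree hC).Strat) (i : ℕ) : (S i).Strat where
  move q := (tau b σ ((S i).lvl q + 1) i).move q
  isChild _ := Strat.isChild _ _

lemma lower_succ {b : Bool} {σ : (tree hC).Strat} {i : ℕ} {q : (S i).Pos}
    (hb : (S i).lvl q % 2 = b.toNat) :
    ((C i).lower b (lower b σ (i + 1))).move q = (lower b σ i).move q := by
  change _ = (tau b σ ((S i).lvl q + 1) i).move q
  rw [← tau_succ _ i q (by omega) hb]
  refine (C i).causal b _ _ q (fun s hs hsb => ?_) hb
  exact (tau_of_le (by omega) (by omega) hsb).symm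

lemma lower_thread {b : Bool} {σ : (tree hC).Strat} {i : ℕ} {t : Thread S C}
    (h : (S i).lvl (t.1 i) < k + i) (hb : (S i).lvl (t.1 i) % 2 = b.toNat) :
    (lower b σ i).move (t.1 i) = (proj hC i).map (σ.move t) :=
  (tau_of_le (Nat.zero_le _) h hb).trans (stage_move σ h)

lemma lift (b : Bool) (σ : (tree hC).Strat) {x : ℕ → (S 0).Pos} (hx : (S 0).IsPlay x)
    (hf : FollowsFrom 0 b (lower b σ 0).move x) :
    ∃ y, (tree hC).IsPlay y ∧ FollowsFrom 0 b σ.move y ∧ ∀ n, (proj hC 0).map (y n) = x n := by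
  let P : ℕ → Type := fun i =>
    {x : ℕ → (S i).Pos // (S i).IsPlay x ∧ FollowsFrom 0 b (lower b σ i).move x}
  have hstep : ∀ i (x : P i), ∃ y : P (i + 1), ∀ n, (C i).map (y.1 n) = x.1 n := by
    intro i x
    obtain ⟨y, h1, h2, h3⟩ := (C i).lift b (lower b σ (i + 1)) x.1 x.2.1 fun n hn hb => by
      rw [lower_succ (by rwa [(x.2.1 n).1])]
      exact x.2.2 n hn hb
    exact ⟨⟨y, h1, h2⟩, h3⟩
  choose f hf' using hstep
  let z : ∀ i, P i := fun i => Nat.rec ⟨x, hx, hf⟩ f i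
  let y : ℕ → Thread S C := fun n => ⟨fun i => (z i).1 n, fun i => hf' i (z i) n⟩
  refine ⟨y, fun n => ⟨(hx n).1, Subtype.ext (funext fun i => ((z i).2.1 n).2)⟩, fun n _ hb => ?_,
    fun _ => rfl⟩
  have hl : ∀ i n, (S i).lvl ((y n).1 i) = n := fun i n => ((z i).2.1 n).1
  refine thread_ext hC (i := n + 1) (by rw [hl]; omega) ?_
  refine ((z (n + 1)).2.2 n n.zero_le hb).trans ?_
  exact lower_thread (t := y n) (by rw [hl]; omega) (by rwa [hl])

variable (hC) in
/-- The inverse limit covers the first tree of the sequence. -/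
noncomputable def cover : Cover (tree hC) (S 0) where
  toHom := proj hC 0
  lower b σ := lower b σ 0
  causal _ _ _ q h hq := tau_congr h _ 0 q le_rfl hq
  lift b σ _ hx hf := lift b σ hx hf

lemma trivialUpTo_cover : (cover hC).TrivialUpTo k := by
  refine ⟨fun q hq => ?_, fun b σ s hs hb => lower_thread hs hb⟩
  obtain ⟨t, rfl⟩ := exists_thread 0 S C k hC q hq
  exact ⟨t, rfl, fun u hu => (thread_ext hC (i := 0) hq hu.symm).symm⟩

end Limit

/-- The sets of plays which can be unravelled, after any further map of trees. -/
def Unravelable (T : GameTree) (W : Set (ℕ → T.Pos)) : Prop :=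
  ∀ (T' : GameTree) (f : Hom T' T) (k : ℕ), ∃ (S : GameTree) (C : Cover S T'),
    C.TrivialUpTo k ∧ S.Decided (C.pre (f.pre W))

lemma Decided.compl {T : GameTree} {W : Set (ℕ → T.Pos)} (h : T.Decided W) : T.Decided Wᶜ := by
  obtain ⟨N, Z, h⟩ := h
  exact ⟨N, Zᶜ, fun x hx => not_congr (h x hx)⟩

lemma Decided.unravelable {T : GameTree} {W : Set (ℕ → T.Pos)} (h : T.Decided W) :
    Unravelable T W := fun T' f k =>
  ⟨T', Cover.id T', Cover.trivialUpTo_id T' k, Hom.decided_pre _ (f.decided_pre h)⟩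

lemma Unravelable.compl {T : GameTree} {W : Set (ℕ → T.Pos)} (h : Unravelable T W) :
    Unravelable T Wᶜ := fun T' f k =>
  let ⟨S, C, h1, h2⟩ := h T' f k
  ⟨S, C, h1, h2.compl⟩

/-- A tree together with a map to `T`. -/
structure Over (T : GameTree) where
  tree : GameTree
  hom : Hom tree T

lemma Unravelable.iUnion {T : GameTree} {W : ℕ → Set (ℕ → T.Pos)}
    (h : ∀ i, Unravelable T (W i)) : Unravelable T (⋃ i, W i) := by
  intro T' f k
  choose S' C' h1 h2 using fun i (A : Over T) => h i A.tree A.hom (k + i)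
  let A : ℕ → Over T := fun i => Nat.rec ⟨T', f⟩
    (fun i A => ⟨S' i A, A.hom.comp (C' i A).toHom⟩) i
  let C : ∀ i, Cover (A (i + 1)).tree (A i).tree := fun i => C' i (A i)
  have hC : ∀ i, (C i).TrivialUpTo (k + i) := fun i => h1 i (A i)
  let π := Limit.proj hC
  have hcomm : ∀ i t, (A i).hom.map ((π i).map t) = f.map ((π 0).map t) := by
    intro i t
    induction i with
    | zero => rfl
    | succ i ih =>
      rw [← ih]
      exact congrArg (A i).hom.map (t.2 i)
  choose N Z hZ using fun i => h2 i (A i)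
  obtain ⟨S, D, hD1, hD2⟩ := exists_cover_of_isOpen (T := Limit.tree hC)
    (D := {q | ∃ i, N i ≤ (Limit.tree hC).lvl q ∧
      (π (i + 1)).map ((Limit.tree hC).anc q (N i)) ∈ Z i})
    (by
      rintro c q hc ⟨i, hi, hq⟩
      have := hc.2
      exact ⟨i, by omega, by rwa [hc.anc hi]⟩) k
  refine ⟨S, (Limit.cover hC).comp D, Limit.trivialUpTo_cover.comp hD1, ?_⟩
  obtain ⟨M, Y, hY⟩ := hD2
  refine ⟨M, Y, fun y hy => ?_⟩
  rw [← hY y hy]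
  have hx := D.toHom.isPlay hy
  set x : ℕ → (Limit.tree hC).Pos := fun n => D.map (y n) with hxdef
  have key : ∀ i, (fun n => f.map ((π 0).map (x n))) ∈ W i ↔ (π (i + 1)).map (x (N i)) ∈ Z i := by
    intro i
    rw [← hZ i _ ((π (i + 1)).isPlay hx)]
    have : (fun n => f.map ((π 0).map (x n))) =
        fun n => (A i).hom.map ((C' i (A i)).map ((π (i + 1)).map (x n))) := by
      funext n
      rw [← hcomm (i + 1)]
      rfl
    rw [this]
    rfl
  change (fun n => f.map ((π 0).map (x n))) ∈ ⋃ i, W i ↔ ∃ n, x n ∈ _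
  rw [Set.mem_iUnion]
  constructor
  · rintro ⟨i, hi⟩
    refine ⟨N i, i, (hx _).1.ge, ?_⟩
    rw [hx.anc le_rfl]
    exact (key i).1 hi
  · rintro ⟨n, i, hi, hn⟩
    rw [(hx n).1] at hi
    rw [hx.anc hi] at hn
    exact ⟨i, (key i).2 hn⟩

end GameTree

namespace GameTree

lemma Decided.determined {T : GameTree} {W : Set (ℕ → T.Pos)} (h : T.Decided W) {r : T.Pos}
    (hr : T.lvl r = 0) :
    (∃ σ : T.Strat, ∀ x, T.IsPlay x → x 0 = r → FollowsFrom 0 false σ.move x → x ∈ W) ∨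
      ∃ σ : T.Strat, ∀ x, T.IsPlay x → x 0 = r → FollowsFrom 0 true σ.move x → x ∉ W := by
  classical
  obtain ⟨N, Z, h⟩ := h
  set V := forced false {p | T.lvl p = N ∧ p ∈ Z} with hV
  by_cases hrV : r ∈ V
  · obtain ⟨σ, hσ⟩ := hrV
    refine .inl ⟨σ, fun x hx hxr hf => ?_⟩
    obtain ⟨n, -, hn, hnZ⟩ := hσ x hx (by rw [hr, hxr]) (by rwa [hr])
    rw [(hx n).1] at hn
    rw [h x hx]
    rwa [← hn]
  · right
    have hex : ∀ q, ∃ c, T.IsChild c q ∧ (q ∉ V → c ∉ V) := by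
      intro q
      by_cases hq : q ∈ V
      · exact ⟨someChild q, isChild_someChild q, fun h => absurd hq h⟩
      · by_contra! hno
        exact hq (forced_of_forall_child fun c hc => not_not.1 fun hcV => hcV (hno c hc).2)
    choose f hf hfV using hex
    refine ⟨⟨f, hf⟩, fun x hx hxr hfol => ?_⟩
    have hxV : ∀ n, x n ∉ V := by
      intro n
      induction n with
      | zero => rwa [hxr]
      | succ n ih =>
        rcases Nat.mod_two_eq_zero_or_one n with h0 | h0
        · exact fun hn => ih (forced_of_child (by rwa [(hx n).1]) (hx.isChild n) hn)
        · rw [hfol n n.zero_le h0]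
          exact hfV _ ih
    rw [h x hx]
    exact fun hZ => hxV N (subset_forced _ _ ⟨(hx N).1, hZ⟩)

/-- The tree of finite sequences of elements of `A`, with the latest element first. -/
def list (A : Type) [Nonempty A] : GameTree where
  Pos := List A
  lvl := List.length
  par := List.tail
  lvl_par _ := List.length_tail
  exists_child q := ⟨Classical.arbitrary A :: q, rfl, rfl⟩

end GameTree

/-- The first `n` moves of the sequence `p`, with the latest move first. -/
def history {A : Type} (p : ℕ → A) : ℕ → List A
  | 0 => []
  | n + 1 => p n :: history p n

namespace GameTree

variable {A : Type} [Nonempty A]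

lemma isPlay_history (p : ℕ → A) : (list A).IsPlay (history p) := by
  refine fun n => ⟨?_, rfl⟩
  induction n with
  | zero => rfl
  | succ n ih => exact congrArg (· + 1) ih

/-- The sequence of moves of a play. -/
noncomputable def moves (x : ℕ → List A) (n : ℕ) : A := (x (n + 1)).headD (Classical.arbitrary A)

lemma unravelable_of_measurableSet {W : Set (ℕ → A)}
    (hW : @MeasurableSet _ (@MeasurableSpace.pi ℕ (fun _ => A) fun _ => ⊤) W) :
    Unravelable (list A) (moves ⁻¹' W) := by
  let m : MeasurableSpace (ℕ → A) :=
    { MeasurableSet' := fun W => Unravelable (list A) (moves ⁻¹' W)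
      measurableSet_empty := Decided.unravelable ⟨0, ∅, fun _ _ => Iff.rfl⟩
      measurableSet_compl := fun _ h => h.compl
      measurableSet_iUnion := fun _ h =>
        (congrArg (Unravelable (list A)) Set.preimage_iUnion).mpr (Unravelable.iUnion h) }
  have hle : @MeasurableSpace.pi ℕ (fun _ => A) (fun _ => ⊤) ≤ m := by
    refine iSup_le fun i => ?_
    rintro _ ⟨s, -, rfl⟩
    exact Decided.unravelable
      ⟨i + 1, {q : List A | q.headD (Classical.arbitrary A) ∈ s}, fun _ _ => Iff.rfl⟩
  exact hle W hW

lemma exists_winning {W : Set (ℕ → List A)} {S : GameTree} (C : Cover S (list A)) {r : S.Pos}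
    (hr : ∀ s, C.map s = ([] : List A) → s = r) {b : Bool} (σ : S.Strat)
    (hσ : ∀ x, S.IsPlay x → x 0 = r → FollowsFrom 0 b σ.move x → x ∈ C.pre W) :
    ∃ f : List A → A, ∀ p : ℕ → A,
      (∀ n, n % 2 = b.toNat → p n = f (history p n)) → history p ∈ W := by
  have hex : ∀ q : List A, ∃ a, (C.lower b σ).move q = a :: q := by
    intro q
    obtain ⟨h1, h2⟩ := (C.lower b σ).isChild q
    change List.tail _ = q at h1
    change List.length _ = List.length q + 1 at h2
    cases h : (C.lower b σ).move q with
    | nil => rw [h] at h2; simp at h2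
    | cons a l =>
      rw [h] at h1
      exact ⟨a, by rw [← h1]; rfl⟩
  choose f hf using hex
  refine ⟨f, fun p hp => ?_⟩
  obtain ⟨y, hy, hyf, hyp⟩ := C.lift b σ (history p) (isPlay_history p) fun n _ hn => by
    rw [hf, ← hp n hn]
    rfl
  have h := hσ y hy (hr _ (hyp 0)) hyf
  change (fun n => C.map (y n)) ∈ W at h
  rwa [show (fun n => C.map (y n)) = history p from funext hyp] at h

end GameTree

/-- **Borel determinacy** (Martin): the infinite game on a discrete set `A` with a Borel winning
set `W` is determined. -/
theorem borel_determinacy {A : Type} [Nonempty A] {W : Set (ℕ → A)}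
    (hW : @MeasurableSet _ (@MeasurableSpace.pi ℕ (fun _ => A) fun _ => ⊤) W) :
    (∃ f : List A → A, ∀ p : ℕ → A, (∀ n, n % 2 = 0 → p n = f (history p n)) → p ∈ W) ∨
      ∃ f : List A → A, ∀ p : ℕ → A, (∀ n, n % 2 = 1 → p n = f (history p n)) → p ∉ W := by
  open GameTree in
  obtain ⟨S, C, hC, hdec⟩ := unravelable_of_measurableSet hW (list A) (Hom.id _) 0
  obtain ⟨r, hr, huniq⟩ := hC.1 ([] : List A) le_rfl
  have hr0 : S.lvl r = 0 := by
    rw [← C.lvl_map, hr]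
    rfl
  rcases hdec.determined hr0 with ⟨σ, hσ⟩ | ⟨σ, hσ⟩
  · exact .inl (exists_winning (W := moves ⁻¹' W) C huniq σ hσ)
  · exact .inr (exists_winning (W := (moves ⁻¹' W)ᶜ) C huniq σ hσ)

namespace FreeProd

open Monoid.CoprodI Classical

variable {G : Bool → Type} [∀ s, Group (G s)]

/-- The length of the reduced word representing `w`. -/
noncomputable def len (w : Monoid.CoprodI G) : ℕ := (Word.equiv w).toList.length

/-- The factor in which the first letter of the reduced word representing `w` lives. -/
noncomputable def front (w : Monoid.CoprodI G) : Option Bool := (Word.equiv w).fstIdx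

/-- The first letter of `w` if it lies in `G s`, and `1` otherwise. -/
noncomputable def head (s : Bool) (w : Monoid.CoprodI G) : G s :=
  (Word.equivPair s (Word.equiv w)).head

/-- What remains of `w` after removing `head s w`. -/
noncomputable def tail (s : Bool) (w : Monoid.CoprodI G) : Monoid.CoprodI G :=
  (Word.equivPair s (Word.equiv w)).tail.prod

lemma equiv_prod (w : Word G) : Word.equiv w.prod = w := Word.equiv.apply_symm_apply w

lemma equiv_mul (g w : Monoid.CoprodI G) : Word.equiv (g * w) = g • Word.equiv w :=
  mul_smul g w _

lemma equiv_one : Word.equiv (1 : Monoid.CoprodI G) = Word.empty :=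
  one_smul (Monoid.CoprodI G) Word.empty

lemma head_of_front_ne {s : Bool} {w : Monoid.CoprodI G} (h : front w ≠ some s) :
    head s w = 1 := by
  rw [head, Word.equivPair_eq_of_fstIdx_ne h]

lemma tail_of_front_ne {s : Bool} {w : Monoid.CoprodI G} (h : front w ≠ some s) :
    tail s w = w := by
  rw [tail, Word.equivPair_eq_of_fstIdx_ne h]
  exact Word.equiv.symm_apply_apply w

lemma head_of_mul (s : Bool) (γ : G s) (w : Monoid.CoprodI G) :
    head s (of γ * w) = γ * head s w := by
  rw [head, equiv_mul, Word.equivPair_smul_same]; rfl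

lemma tail_of_mul (s : Bool) (γ : G s) (w : Monoid.CoprodI G) :
    tail s (of γ * w) = tail s w := by
  rw [tail, equiv_mul, Word.equivPair_smul_same]; rfl

lemma front_tail_ne (s : Bool) (w : Monoid.CoprodI G) : front (tail s w) ≠ some s := by
  rw [front, tail, equiv_prod]
  exact (Word.equivPair s (Word.equiv w)).fstIdx_ne

lemma equiv_of_mul {s : Bool} {γ : G s} (hγ : γ ≠ 1) {w : Monoid.CoprodI G}
    (h : front w ≠ some s) : Word.equiv (of γ * w) = Word.cons γ (Word.equiv w) h hγ := by
  apply Word.equiv.symm.injective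
  rw [Equiv.symm_apply_apply]
  refine Eq.trans ?_ (Word.prod_cons s γ _ hγ h).symm
  exact congrArg (of γ * ·) (Word.equiv.symm_apply_apply w).symm

lemma front_of_mul {s : Bool} {γ : G s} (hγ : γ ≠ 1) {w : Monoid.CoprodI G}
    (h : front w ≠ some s) : front (of γ * w) = some s := by
  rw [front, equiv_of_mul hγ h]
  exact Word.fstIdx_cons _ _ _ _

lemma len_of_mul {s : Bool} {γ : G s} (hγ : γ ≠ 1) {w : Monoid.CoprodI G}
    (h : front w ≠ some s) : len (of γ * w) = len w + 1 := by
  rw [len, equiv_of_mul hγ h]; rfl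

lemma of_head_mul_tail (s : Bool) (w : Monoid.CoprodI G) : of (head s w) * tail s w = w := by
  rw [head, tail, ← Word.prod_smul]
  exact (congrArg Word.prod (Word.equivPair_head_smul_equivPair_tail _)).trans
    (Word.equiv.symm_apply_apply w)

lemma len_tail {s : Bool} {w : Monoid.CoprodI G} (h : front w = some s) :
    len (tail s w) + 1 = len w := by
  have h1 : head s w ≠ 1 := fun h1 => by
    have := of_head_mul_tail s w
    rw [h1, map_one, one_mul] at this
    exact front_tail_ne s w (by rwa [this])
  rw [← len_of_mul h1 (front_tail_ne s w), of_head_mul_tail]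

@[simp] lemma len_one : len (1 : Monoid.CoprodI G) = 0 := by
  rw [len, equiv_one]; rfl

@[simp] lemma front_one : front (1 : Monoid.CoprodI G) = none := by
  rw [front, equiv_one]; rfl

@[simp] lemma head_one (s : Bool) : head s (1 : Monoid.CoprodI G) = 1 :=
  head_of_front_ne (by simp)

@[simp] lemma tail_one (s : Bool) : tail s (1 : Monoid.CoprodI G) = 1 :=
  tail_of_front_ne (by simp)

lemma eq_one_of_front {w : Monoid.CoprodI G} (h : front w = none) : w = 1 := by
  apply Word.equiv.injective
  ext1
  have : (Word.equiv w).toList = [] := by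
    rw [front, Word.fstIdx] at h
    simpa using h
  rw [this, equiv_one]; rfl

lemma len_pos {w : Monoid.CoprodI G} (h : w ≠ 1) : 0 < len w := by
  obtain ⟨s, hs⟩ := Option.ne_none_iff_exists'.1 fun h' => h (eq_one_of_front h')
  rw [← len_tail hs]; omega

end FreeProd

namespace FreeProd

open Monoid.CoprodI Classical

/-- Right-translated evaluation: the action of `F` on labellings of `F`. -/
def act {F L : Type} [Group F] (g : F) (y : F → L) : F → L := fun h => y (g * h)

lemma act_act {F L : Type} [Group F] (g h : F) (y : F → L) : act g (act h y) = act (h * g) y := by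
  funext x; simp [act, mul_assoc]

@[simp] lemma act_one {F L : Type} [Group F] (y : F → L) : act 1 y = y := by
  funext x; simp [act]

variable {G : Bool → Type} [∀ s, Group (G s)] {L : Type}

/-- The labels on the coset `G s` of the identity are pairwise distinct. -/
def Rainbow (s : Bool) (y : Monoid.CoprodI G → L) : Prop :=
  Function.Injective fun γ : G s => y (of γ)

/-- The set `B` does not contain the whole `G true`-orbit of `y`, and meets its `G false`-orbit,
provided the labels on these orbits are pairwise distinct. -/
def SolvedAt (B : Set (Monoid.CoprodI G → L)) (y : Monoid.CoprodI G → L) : Prop :=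
  ∀ s, Rainbow s y → ∃ γ : G s, (act (of γ) y ∈ B ↔ s = false)

/-- The parity of the rounds in which the label of `w` is chosen. -/
noncomputable def parity (w : Monoid.CoprodI G) : ℕ := if front w = some true then 0 else 1

lemma parity_eq {s : Bool} {w : Monoid.CoprodI G} (h : front w = some (!s)) :
    parity w = s.toNat := by
  cases s <;> simp [parity, h]

/-- The labelling produced by the play `p` when the identity is labelled `k`. -/
noncomputable def outcome (k : L) (p : ℕ → Monoid.CoprodI G → L) : Monoid.CoprodI G → L :=
  fun w => if w = 1 then k else p (2 * (len w - 1) + parity w) w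

lemma measurable_of_coordinates {A F L : Type} [MeasurableSpace L] (φ : (ℕ → A) → F → L)
    (h : ∀ w, (∃ l, ∀ p, φ p w = l) ∨ ∃ j, ∃ e : A → L, ∀ p, φ p w = e (p j)) :
    @Measurable _ _ (@MeasurableSpace.pi ℕ (fun _ => A) fun _ => ⊤) _ φ := by
  let : MeasurableSpace A := ⊤
  refine measurable_pi_iff.2 fun w => ?_
  rcases h w with ⟨l, hl⟩ | ⟨j, e, he⟩
  · simp only [hl]; exact measurable_const
  · simp only [he]; exact measurable_from_top.comp (measurable_pi_apply j)

lemma measurable_outcome [MeasurableSpace L] (k : L) :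
    @Measurable _ _ (@MeasurableSpace.pi ℕ (fun _ => Monoid.CoprodI G → L) fun _ => ⊤) _
      (outcome (G := G) k) := by
  refine measurable_of_coordinates _ fun w => ?_
  by_cases hw : w = 1
  · exact .inl ⟨k, fun p => if_pos hw⟩
  · exact .inr ⟨_, fun a => a w, fun p => if_neg hw⟩

lemma exists_recursive {X : Type} [Nonempty X] (Φ : ℕ → (ℕ → X) → X)
    (hΦ : ∀ t m m', (∀ i < t, m i = m' i) → Φ t m = Φ t m') : ∃ m : ℕ → X, ∀ t, m t = Φ t m := by
  let step (t : ℕ) (ih : ∀ i, i < t → X) : X :=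
    Φ t fun i => if h : i < t then ih i h else Classical.arbitrary X
  refine ⟨Nat.lt_wfRel.wf.fix step, fun t => ?_⟩
  rw [WellFounded.fix_eq]
  exact hΦ t _ _ fun i hi => dif_pos hi

lemma history_congr {A : Type} {p q : ℕ → A} {n : ℕ} (h : ∀ i < n, p i = q i) :
    history p n = history q n := by
  induction n with
  | zero => rfl
  | succ n ih => rw [history, history, h n n.lt_succ_self, ih fun i hi => h i (by omega)]

/-- The player moving in rounds of parity `s` can force the outcome into `B` (if `s`) or out of
`B` (otherwise). -/
def Wins (B : Set (Monoid.CoprodI G → L)) (s : Bool) (k : L) : Prop :=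
  ∃ f : List (Monoid.CoprodI G → L) → Monoid.CoprodI G → L, ∀ p,
    (∀ n, n % 2 = s.toNat → p n = f (history p n)) → (outcome k p ∈ B ↔ s = true)

lemma wins_or_wins [MeasurableSpace L] [Nonempty L] {B : Set (Monoid.CoprodI G → L)}
    (hB : MeasurableSet B) (k : L) : Wins B true k ∨ Wins B false k := by
  rcases borel_determinacy (measurable_outcome (G := G) k hB.compl) with ⟨f, hf⟩ | ⟨f, hf⟩
  · exact .inr ⟨f, fun p hp => by simpa using hf p hp⟩
  · exact .inl ⟨f, fun p hp => by simpa using hf p hp⟩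

/-- Playing winning strategies for distinct labels against each other. -/
lemma exists_forall_mem_iff [Nonempty L] {B : Set (Monoid.CoprodI G → L)} {s : Bool} (k : G s → L)
    (hk : ∀ γ, Wins B s (k γ)) :
    ∃ y : Monoid.CoprodI G → L, (∀ γ, y (of γ) = k γ) ∧ ∀ γ : G s, act (of γ) y ∈ B ↔ s = true := by
  choose f hf using hk
  let play (m : ℕ → G s → Monoid.CoprodI G → L) (γ : G s) (j : ℕ) : Monoid.CoprodI G → L :=
    if j % 2 = s.toNat then m (j / 2) γ else fun w =>
      if j / 2 = 0 then k (γ * head s w) else m (j / 2 - 1) (γ * head s w) (tail s w)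
  have hs : s.toNat < 2 := Bool.toNat_lt s
  obtain ⟨m, hm⟩ := exists_recursive
    (fun t m (γ : G s) => f γ (history (play m γ) (2 * t + s.toNat))) (by
      intro t m m' h
      funext γ
      refine congrArg _ (history_congr fun j hj => ?_)
      by_cases hj' : j % 2 = s.toNat
      · simp only [play, if_pos hj']
        rw [h _ (by omega)]
      · simp only [play, if_neg hj']
        funext w
        split_ifs
        · rfl
        · rw [h _ (by omega)])
  refine ⟨fun w => if tail s w = 1 then k (head s w) else
    m (len (tail s w) - 1) (head s w) (tail s w), fun γ => ?_, fun γ => ?_⟩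
  · have h1 := head_of_mul s γ 1
    have h2 := tail_of_mul s γ 1
    simp only [mul_one, head_one, tail_one] at h1 h2
    simp [h1, h2]
  · rw [← hf γ (play m γ) fun n hn => ?_]
    · refine iff_of_eq (congrArg (· ∈ B) ?_)
      funext w
      simp only [act, head_of_mul, tail_of_mul, outcome]
      by_cases hw : w = 1
      · subst hw
        simp
      · rw [if_neg hw]
        have hlen := len_pos hw
        by_cases hfr : front w = some s
        · have hpar : parity w = (!s).toNat := parity_eq (by simpa using hfr)
          have hne : ¬ (2 * (len w - 1) + parity w) % 2 = s.toNat := by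
            rw [hpar]; cases s <;> simp
          have hdiv : (2 * (len w - 1) + parity w) / 2 = len w - 1 := by
            have := Bool.toNat_lt (!s)
            omega
          have hl := len_tail hfr
          simp only [play, if_neg hne, hdiv]
          by_cases ht : tail s w = 1
          · rw [ht, len_one] at hl
            rw [if_pos ht, if_pos (by omega)]
          · have := len_pos ht
            rw [if_neg ht, if_neg (by omega)]
            congr 2
            omega
        · have hfr' : front w = some (!s) := by
            obtain ⟨i, hi⟩ := Option.ne_none_iff_exists'.1 fun h => hw (eq_one_of_front h)
            rw [hi] at hfr ⊢
            simpa [Bool.eq_not] using hfr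
          have hpar : parity w = s.toNat := parity_eq hfr'
          rw [head_of_front_ne hfr, tail_of_front_ne hfr, if_neg hw, mul_one, hpar]
          have h1 : (2 * (len w - 1) + s.toNat) % 2 = s.toNat := by omega
          have h2 : (2 * (len w - 1) + s.toNat) / 2 = len w - 1 := by omega
          simp only [play, if_pos h1, h2]
    · have h2 : 2 * (n / 2) + s.toNat = n := by omega
      have := congrFun (hm (n / 2)) γ
      rw [h2] at this
      simp only [play, if_pos hn]
      exact this

theorem exists_not_solvedAt [∀ s, Finite (G s)] [Finite L] [MeasurableSpace L]
    (hcard : Nat.card (G true) + Nat.card (G false) ≤ Nat.card L + 1)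
    {B : Set (Monoid.CoprodI G → L)} (hB : MeasurableSet B) : ∃ y, ¬ SolvedAt B y := by
  have hG : ∀ s, 0 < Nat.card (G s) := fun s => Nat.card_pos
  have : Nonempty L := (Nat.card_pos_iff.1 (by have := hG true; have := hG false; omega)).1
  have hs : ∃ s, Nat.card (G s) ≤ Set.ncard {k | Wins B s k} := by
    by_contra! h
    have h1 := Set.ncard_union_le {k | Wins B true k} {k | Wins B false k}
    rw [show {k | Wins B true k} ∪ {k | Wins B false k} = Set.univ from
      Set.eq_univ_of_forall (wins_or_wins hB), Set.ncard_univ] at h1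
    have := h true
    have := h false
    omega
  obtain ⟨s, hs⟩ := hs
  have : Fintype (G s) := Fintype.ofFinite _
  have : Fintype {k | Wins B s k} := Fintype.ofFinite _
  rw [← Nat.card_coe_set_eq, Nat.card_eq_fintype_card, Nat.card_eq_fintype_card] at hs
  obtain ⟨k⟩ := Function.Embedding.nonempty_of_card_le hs
  obtain ⟨y, hy1, hy2⟩ := exists_forall_mem_iff (fun γ => (k γ : L)) fun γ => (k γ).2
  refine ⟨y, fun h => ?_⟩
  obtain ⟨γ, hγ⟩ := h s (by
    simp only [Rainbow, hy1]
    exact Subtype.val_injective.comp k.injective)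
  rw [hy2] at hγ
  cases s <;> simp at hγ

end FreeProd

namespace FreeProd

open Monoid.CoprodI

variable {G : Bool → Type} [∀ s, Group (G s)] {L : Type}

/-- `P` occurs strictly before `Q`. -/
def Before (P Q : ℕ → Prop) : Prop := ∃ e, P e ∧ ∀ j ≤ e, ¬ Q j

lemma Before.asymm {P Q : ℕ → Prop} (h : Before P Q) : ¬ Before Q P := by
  rintro ⟨i, hi, hi'⟩
  obtain ⟨j, hj, hj'⟩ := h
  rcases le_total i j with h | h
  · exact hj' i h hi
  · exact hi' j h hj

lemma act_of_act_of {s : Bool} (γ δ : G s) (y : Monoid.CoprodI G → L) :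
    act (of γ) (act (of δ) y) = act (of (δ * γ)) y := by
  rw [act_act, map_mul]

lemma rainbow_act {s : Bool} (γ : G s) {y : Monoid.CoprodI G → L} (h : Rainbow s y) :
    Rainbow s (act (of γ) y) := by
  intro a b hab
  simp only [act, ← map_mul] at hab
  exact mul_left_cancel (h hab)

lemma measurable_act [MeasurableSpace L] {F : Type} [Group F] (g : F) :
    Measurable (act g : (F → L) → F → L) :=
  measurable_pi_iff.2 fun h => measurable_pi_apply (g * h)

/-- There is a single Borel set which is correct at every point of `Z`. -/
def Solved [MeasurableSpace L] (Z : Set (Monoid.CoprodI G → L)) : Prop :=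
  ∃ B, MeasurableSet B ∧ ∀ y ∈ Z, SolvedAt B y

/-- Invariance under the action. -/
def Invariant (Z : Set (Monoid.CoprodI G → L)) : Prop := ∀ g y, y ∈ Z → act g y ∈ Z

lemma Invariant.act_mem_iff {Z : Set (Monoid.CoprodI G → L)} (hZ : Invariant Z)
    (g : Monoid.CoprodI G) {y : Monoid.CoprodI G → L} : act g y ∈ Z ↔ y ∈ Z := by
  refine ⟨fun h => ?_, hZ g y⟩
  simpa [act_act] using hZ g⁻¹ _ h

lemma invariant_of_forall {Z : Set (Monoid.CoprodI G → L)}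
    (h : ∀ s (γ : G s), ∀ y ∈ Z, act (of γ) y ∈ Z) : Invariant Z := by
  intro g
  induction g using Monoid.CoprodI.induction_on with
  | one => simp
  | of i m => exact h i m
  | mul a b ha hb => exact fun y hy => by rw [← act_act]; exact hb _ (ha _ hy)

lemma SolvedAt.congr {B B' : Set (Monoid.CoprodI G → L)} {y : Monoid.CoprodI G → L}
    (h : SolvedAt B y) (hB : ∀ g, act g y ∈ B ↔ act g y ∈ B') : SolvedAt B' y := by
  intro s hs
  obtain ⟨γ, hγ⟩ := h s hs
  exact ⟨γ, by rw [← hB, hγ]⟩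

lemma Solved.iUnion [MeasurableSpace L] {ι : Type} [Countable ι]
    {Z : ι → Set (Monoid.CoprodI G → L)} (hinv : ∀ i, Invariant (Z i))
    (hm : ∀ i, MeasurableSet (Z i)) (h : ∀ i, Solved (Z i)) : Solved (⋃ i, Z i) := by
  classical
  choose B hB hBs using h
  obtain ⟨e, he⟩ := Countable.exists_injective_nat ι
  refine ⟨⋃ i, (Z i ∩ B i) \ ⋃ j, ⋃ (_ : e j < e i), Z j, ?_, fun y hy => ?_⟩
  · exact MeasurableSet.iUnion fun i => ((hm i).inter (hB i)).diff
      (MeasurableSet.iUnion fun j => MeasurableSet.iUnion fun _ => hm j)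
  · obtain ⟨i₀, hi₀⟩ := Set.mem_iUnion.1 hy
    have hi := Function.argminOn_mem e {i | y ∈ Z i} ⟨i₀, hi₀⟩
    have hmin := fun j (hj : y ∈ Z j) => Function.not_lt_argminOn e {i | y ∈ Z i} hj
    set i := Function.argminOn e {i | y ∈ Z i} ⟨i₀, hi₀⟩
    refine (hBs i y hi).congr fun g => ?_
    simp only [Set.mem_iUnion, Set.mem_sdiff, Set.mem_inter_iff, (hinv _).act_mem_iff]
    constructor
    · exact fun hg => ⟨i, ⟨hi, hg⟩, fun ⟨j, hj, hyj⟩ => hmin j hyj hj⟩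
    · rintro ⟨j, ⟨hyj, hg⟩, hj⟩
      have : e i = e j := le_antisymm (not_lt.1 (hmin j hyj)) (not_lt.1 fun h => hj ⟨i, h, hi⟩)
      rwa [he this]

/-- The points from which `tgt` can be reached in `n` steps, the first of which is in `G s`. -/
def reach (tgt : Bool → Set (Monoid.CoprodI G → L)) : ℕ → Bool → Set (Monoid.CoprodI G → L)
  | 0, s => tgt s
  | n + 1, s => {y | ∃ γ : G s, act (of γ) y ∈ reach tgt n (!s)}

lemma reach_act {tgt : Bool → Set (Monoid.CoprodI G → L)}
    (htgt : ∀ s (γ : G s), ∀ y ∈ tgt s, act (of γ) y ∈ tgt s) (n : ℕ) (s : Bool) (γ : G s)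
    {y : Monoid.CoprodI G → L} (h : y ∈ reach tgt n s) :
    act (of γ) y ∈ reach tgt n s := by
  cases n with
  | zero => exact htgt s γ y h
  | succ n =>
    obtain ⟨δ, hδ⟩ := h
    exact ⟨γ⁻¹ * δ, by rw [act_of_act_of]; simpa using hδ⟩

lemma reach_succ {tgt : Bool → Set (Monoid.CoprodI G → L)} {n : ℕ} {s : Bool}
    {y : Monoid.CoprodI G → L} (h : y ∈ reach tgt n (!s)) :
    y ∈ reach tgt (n + 1) s := ⟨1, by simpa using h⟩

lemma invariant_reach {tgt : Bool → Set (Monoid.CoprodI G → L)}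
    (htgt : ∀ s (γ : G s), ∀ y ∈ tgt s, act (of γ) y ∈ tgt s) :
    Invariant {y | ∃ n s, y ∈ reach tgt n s} := by
  refine invariant_of_forall fun s γ y ⟨n, t, hy⟩ => ?_
  by_cases hst : t = s
  · subst hst
    exact ⟨n, t, reach_act htgt n t γ hy⟩
  · obtain rfl : t = !s := by simpa [Bool.eq_not] using hst
    exact ⟨n + 1, s, reach_act htgt _ s γ (reach_succ hy)⟩

lemma measurableSet_reach [MeasurableSpace L] [∀ s, Countable (G s)]
    {tgt : Bool → Set (Monoid.CoprodI G → L)} (h : ∀ s, MeasurableSet (tgt s)) (n : ℕ) (s : Bool) :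
    MeasurableSet (reach tgt n s) := by
  induction n generalizing s with
  | zero => exact h s
  | succ n ih =>
    rw [reach, Set.ofPred_exists]
    exact MeasurableSet.iUnion fun γ => measurable_act _ (ih _)

lemma measurableSet_before {Y : Type} [MeasurableSpace Y] {P Q : ℕ → Set Y}
    (hP : ∀ i, MeasurableSet (P i)) (hQ : ∀ i, MeasurableSet (Q i)) :
    MeasurableSet {y | Before (fun i => y ∈ P i) (fun i => y ∈ Q i)} := by
  simp only [Before, Set.ofPred_exists, Set.ofPred_and, Set.ofPred_forall]
  exact MeasurableSet.iUnion fun e => (hP e).inter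
    (MeasurableSet.iInter fun j => MeasurableSet.iInter fun _ => (hQ j).compl)

/-- The edges are oriented towards `tgt`, and inside `tgt` by the order of occurrence in `κ`. -/
lemma solved_reach [MeasurableSpace L] [∀ s, Countable (G s)]
    {tgt : Bool → Set (Monoid.CoprodI G → L)} (hm : ∀ s, MeasurableSet (tgt s))
    (htgt : ∀ s (γ : G s), ∀ y ∈ tgt s, act (of γ) y ∈ tgt s)
    (κ : ℕ → Bool → Set (Monoid.CoprodI G → L)) (hκ : ∀ i s, MeasurableSet (κ i s))
    (H : ∀ s y, Rainbow s y → y ∈ tgt s → ∃ γ : G s, act (of γ) y ∈ tgt (!s) ∧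
      Before (fun i => act (of γ) y ∈ κ i (!s)) (fun i => act (of γ) y ∈ κ i s)) :
    Solved {y | ∃ n s, y ∈ reach tgt n s} := by
  let D (s : Bool) : Set (Monoid.CoprodI G → L) :=
    {y | Before (fun i => y ∈ reach tgt i s) (fun i => y ∈ reach tgt i (!s))} ∪
      (tgt s ∩ tgt (!s) ∩ {y | Before (fun i => y ∈ κ i s) (fun i => y ∈ κ i (!s))})
  have hD : ∀ y ∈ D false, y ∉ D true := by
    rintro y (h | ⟨⟨h1, h2⟩, h3⟩) (h' | ⟨⟨h1', h2'⟩, h3'⟩)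
    · exact h.asymm h'
    · obtain ⟨e, -, he⟩ := h
      exact he 0 (Nat.zero_le _) h1'
    · obtain ⟨e, -, he⟩ := h'
      exact he 0 (Nat.zero_le _) h1
    · exact Before.asymm h3 h3'
  refine ⟨D true, ?_, fun y hy s hs => ?_⟩
  · exact (measurableSet_before (fun i => measurableSet_reach hm i _)
      fun i => measurableSet_reach hm i _).union
      (((hm _).inter (hm _)).inter (measurableSet_before (fun i => hκ i _) fun i => hκ i _))
  suffices h : ∃ γ : G s, act (of γ) y ∈ D (!s) by
    obtain ⟨γ, hγ⟩ := h
    refine ⟨γ, ?_⟩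
    cases s
    · simpa using hγ
    · simpa using hD _ hγ
  classical
  have hex : ∃ n, y ∈ reach tgt n s := by
    obtain ⟨n, t, hy⟩ := hy
    by_cases hst : t = s
    · exact ⟨n, hst ▸ hy⟩
    · obtain rfl : t = !s := by simpa [Bool.eq_not] using hst
      exact ⟨n + 1, reach_succ hy⟩
  obtain ⟨e, he, hmin⟩ : ∃ e, y ∈ reach tgt e s ∧ ∀ j < e, y ∉ reach tgt j s :=
    ⟨Nat.find hex, Nat.find_spec hex, fun j hj => Nat.find_min hex hj⟩
  cases e with
  | zero =>
    obtain ⟨γ, hγ, hγ'⟩ := H s y hs he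
    exact ⟨γ, .inr ⟨⟨hγ, by simpa using htgt s γ y he⟩, by simpa using hγ'⟩⟩
  | succ e =>
    obtain ⟨γ, hγ⟩ := he
    refine ⟨γ, .inl ⟨e, hγ, fun j hj h => hmin j (by omega) ?_⟩⟩
    rw [Bool.not_not] at h
    have := reach_act htgt j s γ⁻¹ h
    rwa [act_of_act_of, mul_inv_cancel, map_one, act_one] at this

lemma measurableSet_exists_reach [MeasurableSpace L] [∀ s, Countable (G s)]
    {tgt : Bool → Set (Monoid.CoprodI G → L)} (h : ∀ s, MeasurableSet (tgt s)) :
    MeasurableSet {y | ∃ n s, y ∈ reach tgt n s} := by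
  simp only [Set.ofPred_exists]
  exact MeasurableSet.iUnion fun n => MeasurableSet.iUnion fun s => measurableSet_reach h n s

lemma measurableSet_rainbow [MeasurableSpace L] [MeasurableSingletonClass L] [Countable L]
    [∀ s, Countable (G s)] (s : Bool) :
    MeasurableSet {y : Monoid.CoprodI G → L | Rainbow s y} := by
  simp only [Rainbow, Function.Injective, Set.ofPred_forall]
  refine MeasurableSet.iInter fun a => MeasurableSet.iInter fun b => ?_
  by_cases hab : a = b
  · simp [hab]
  · have := (measurableSet_eq_fun (f := fun y : Monoid.CoprodI G → L => y (of a))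
      (measurable_pi_apply _) (measurable_pi_apply (of b))).compl
    convert this using 1
    ext y
    simp [hab]

/-- The points all of whose translates satisfy both conditions `Rainbow s`. -/
def regular (G : Bool → Type) [∀ s, Group (G s)] (L : Type) : Set (Monoid.CoprodI G → L) :=
  {y | ∀ g s, Rainbow s (act g y)}

lemma Solved.mono [MeasurableSpace L] {Z Z' : Set (Monoid.CoprodI G → L)} (h : Solved Z)
    (hZ : Z' ⊆ Z) : Solved Z' :=
  h.imp fun _ hB => ⟨hB.1, fun y hy => hB.2 y (hZ hy)⟩

/-- A set is almost solved if it lies in a solved invariant Borel set. -/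
def Absorbed [MeasurableSpace L] (Z : Set (Monoid.CoprodI G → L)) : Prop :=
  ∃ Z', Z ⊆ Z' ∧ Invariant Z' ∧ MeasurableSet Z' ∧ Solved Z'

lemma Absorbed.iUnion [MeasurableSpace L] {ι : Type} [Countable ι]
    {Z : ι → Set (Monoid.CoprodI G → L)} (h : ∀ i, Absorbed (Z i)) : Absorbed (⋃ i, Z i) := by
  choose Z' hZ hinv hm hs using h
  refine ⟨⋃ i, Z' i, Set.iUnion_mono hZ, fun g y hy => ?_, .iUnion hm, .iUnion hinv hm hs⟩
  obtain ⟨i, hi⟩ := Set.mem_iUnion.1 hy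
  exact Set.mem_iUnion.2 ⟨i, hinv i g y hi⟩

lemma absorbed_compl_regular [MeasurableSpace L] [MeasurableSingletonClass L] [Countable L]
    [∀ s, Countable (G s)] : Absorbed (regular G L)ᶜ := by
  let tgt (s : Bool) : Set (Monoid.CoprodI G → L) := {y | ¬ Rainbow s y}
  have htgt : ∀ s (γ : G s), ∀ y ∈ tgt s, act (of γ) y ∈ tgt s := fun s γ y hy h =>
    hy (by simpa [act_act] using rainbow_act γ⁻¹ h)
  have hm : ∀ s, MeasurableSet (tgt s) := fun s => (measurableSet_rainbow s).compl
  refine ⟨_, fun y hy => ?_, invariant_reach htgt, measurableSet_exists_reach hm,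
    solved_reach hm htgt (fun _ _ => ∅) (fun _ _ => .empty) fun s y h h' => (h' h).elim⟩
  simp only [regular, Set.mem_compl_iff, Set.mem_ofPred_eq, not_forall] at hy
  obtain ⟨g, s, h⟩ := hy
  exact ((invariant_reach htgt).act_mem_iff g).1 ⟨0, s, h⟩

/-- The product of the `k` letters of the sequence `x` from the `i`-th one on. -/
def path (x : ℕ → Σ s, G s) : ℕ → ℕ → Monoid.CoprodI G
  | _, 0 => 1
  | i, k + 1 => of (x i).2 * path x (i + 1) k

/-- The point `y` carries the labels of the sequence `r` from the `i`-th one on along the path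
described by its letters. -/
def Carries (r : ℕ → (Σ s, G s) × L) (i : ℕ) (y : Monoid.CoprodI G → L) : Prop :=
  ∀ k, y (path (fun j => (r j).1) i k) = (r (i + k)).2

lemma Carries.next {r : ℕ → (Σ s, G s) × L} {i : ℕ} {y : Monoid.CoprodI G → L}
    (h : Carries r i y) : Carries r (i + 1) (act (of (r i).1.2) y) := by
  intro k
  rw [add_right_comm, add_assoc]
  exact h (k + 1)

lemma absorbed_carries [MeasurableSpace L] [MeasurableSingletonClass L] [Countable L]
    [∀ s, Countable (G s)] (r : ℕ → (Σ s, G s) × L) (hside : ∀ i, (r (i + 1)).1.1 = !(r i).1.1)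
    (hne : ∀ i, (r i).1.2 ≠ 1) :
    Absorbed {y | ∃ i g, Carries r i (act g y)} := by
  let κ (i : ℕ) (s : Bool) : Set (Monoid.CoprodI G → L) := {y | (r i).1.1 = s ∧ Carries r i y}
  let tgt (s : Bool) : Set (Monoid.CoprodI G → L) := {y | ∃ γ : G s, ∃ i, act (of γ) y ∈ κ i (!s)}
  have hκ : ∀ i s, MeasurableSet (κ i s) := fun i s => by
    have : {y | Carries r i y} =
        ⋂ k, (fun y => y (path (fun j => (r j).1) i k)) ⁻¹' {(r (i + k)).2} := by
      ext; simp [Carries]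
    have hC : MeasurableSet {y : Monoid.CoprodI G → L | Carries r i y} := by
      rw [this]
      exact MeasurableSet.iInter fun k => measurable_pi_apply _ (measurableSet_singleton _)
    exact (MeasurableSet.const _).inter hC
  have hm : ∀ s, MeasurableSet (tgt s) := fun s => by
    have : tgt s = ⋃ γ : G s, ⋃ i, act (of γ) ⁻¹' κ i (!s) := by ext; simp [tgt]
    rw [this]
    exact MeasurableSet.iUnion fun γ => MeasurableSet.iUnion fun i => measurable_act _ (hκ _ _)
  have htgt : ∀ s (γ : G s), ∀ y ∈ tgt s, act (of γ) y ∈ tgt s := fun s γ y ⟨δ, i, h⟩ =>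
    ⟨γ⁻¹ * δ, i, by rw [act_of_act_of]; simpa using h⟩
  have hnext : ∀ i s y, y ∈ κ i s → ∃ l : G s, l ≠ 1 ∧
      act (of l) y ∈ κ (i + 1) (!s) := by
    rintro i s y ⟨rfl, h⟩
    exact ⟨(r i).1.2, hne i, hside i, h.next⟩
  refine ⟨_, ?_, invariant_reach htgt, measurableSet_exists_reach hm,
    solved_reach hm htgt κ hκ fun s y hy hys => ?_⟩
  · rintro y ⟨i, g, h⟩
    refine ((invariant_reach htgt).act_mem_iff g).1 ⟨0, !(r i).1.1, 1, i, ?_⟩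
    simpa [κ] using h
  · classical
    have hex : ∃ i, ∃ γ : G s, act (of γ) y ∈ κ i (!s) := exists_comm.1 hys
    obtain ⟨i, ⟨γ, hγ⟩, hmin⟩ : ∃ i, (∃ γ : G s, act (of γ) y ∈ κ i (!s)) ∧
        ∀ j < i, ¬ ∃ γ : G s, act (of γ) y ∈ κ j (!s) :=
      ⟨Nat.find hex, Nat.find_spec hex, fun j hj => Nat.find_min hex hj⟩
    obtain ⟨l', -, hl'⟩ := hnext i _ _ hγ
    refine ⟨γ, ⟨l', _, hl'⟩, i, hγ, fun j hj hjκ => ?_⟩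
    obtain ⟨l, hl1, hl⟩ := hnext j _ _ hjκ
    rw [act_of_act_of] at hl
    have hij : i ≤ j + 1 := not_lt.1 fun h => hmin _ h ⟨_, hl⟩
    have hne : i ≠ j := by
      rintro rfl
      have := hγ.1.symm.trans hjκ.1
      simp at this
    obtain rfl : i = j + 1 := by omega
    have h1 := hγ.2 0
    have h2 := hl.2 0
    rw [← h2] at h1
    simp only [path, act, mul_one] at h1
    exact hl1 (by simpa using hy h1)

end FreeProd

namespace FreeProd

open Monoid.CoprodI

variable {G : Bool → Type} [∀ s, Group (G s)] {L : Type}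

lemma path_add (x : ℕ → Σ s, G s) (i j k : ℕ) :
    path x i (j + k) = path x i j * path x (i + j) k := by
  induction j generalizing i with
  | zero => simp [path]
  | succ j ih =>
    rw [show j + 1 + k = j + k + 1 by omega, path, path, ih, mul_assoc,
      show i + 1 + j = i + (j + 1) by omega]

lemma path_periodic {x : ℕ → Σ s, G s} {N : ℕ} (h : Function.Periodic x N) (i k : ℕ) :
    path x (i + N) k = path x i k := by
  induction k generalizing i with
  | zero => rfl
  | succ k ih => rw [path, path, h i, show i + N + 1 = i + 1 + N by omega, ih]

/-- The product of a list of letters. -/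
def listProd (l : List (Σ s, G s)) : Monoid.CoprodI G := (l.map fun x => of x.2).prod

@[simp] lemma listProd_nil : listProd ([] : List (Σ s, G s)) = 1 := rfl

@[simp] lemma listProd_cons (x : Σ s, G s) (l : List (Σ s, G s)) :
    listProd (x :: l) = of x.2 * listProd l := by simp [listProd]

@[simp] lemma listProd_append (l l' : List (Σ s, G s)) :
    listProd (l ++ l') = listProd l * listProd l' := by simp [listProd]

lemma path_eq_listProd (x : ℕ → Σ s, G s) (l : List (Σ s, G s)) (j : ℕ)
    (h : ∀ i (hi : i < l.length), x (j + i) = l[i]) : path x j l.length = listProd l := by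
  induction l generalizing j with
  | nil => rfl
  | cons a l ih =>
    have h0 : x j = a := h 0 (by simp)
    rw [List.length_cons, path, listProd_cons, h0, ih (j + 1) fun i hi => ?_]
    rw [show j + 1 + i = j + (i + 1) by omega, h (i + 1) (by simpa using hi),
      List.getElem_cons_succ]

/-- The product of `l` is a nontrivial element stabilizing a translate of `y`. -/
def Stabilizes (y : Monoid.CoprodI G → L) (l : List (Σ s, G s)) : Prop :=
  listProd l ≠ 1 ∧ ∃ g, act (listProd l) (act g y) = act g y

lemma Stabilizes.rotate {y : Monoid.CoprodI G → L} {l : List (Σ s, G s)} (h : Stabilizes y l)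
    (i : ℕ) : Stabilizes y (l.rotate i) := by
  induction i with
  | zero => simpa using h
  | succ i ih =>
    rw [← List.rotate_rotate]
    generalize l.rotate i = l at ih
    cases l with
    | nil => exact ih
    | cons x t =>
      rw [List.rotate_cons_succ, List.rotate_zero]
      obtain ⟨h1, g, h2⟩ := ih
      refine ⟨fun h => h1 ?_, g * of x.2, ?_⟩
      · simp only [listProd_append, listProd_cons, listProd_nil, mul_one] at h ⊢
        exact mul_eq_one_comm.1 h
      · rw [← act_act, act_act]
        simp only [listProd_append, listProd_cons, listProd_nil, mul_one] at h2 ⊢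
        rw [← mul_assoc, ← act_act, h2]

/-- A list of minimal length among those stabilizing a translate of a regular point. -/
lemma Stabilizes.reduced {y : Monoid.CoprodI G → L} (hy : y ∈ regular G L) {l : List (Σ s, G s)}
    (h : Stabilizes y l) (hmin : ∀ l', Stabilizes y l' → l.length ≤ l'.length) :
    ∃ a b t, l = a :: b :: t ∧ a.2 ≠ 1 ∧ b.1 = !a.1 := by
  obtain ⟨h1, g, h2⟩ := h
  match l with
  | [] => simp at h1
  | a :: t =>
    have ha : a.2 ≠ 1 := fun ha => by
      have := hmin t (by
        simp only [listProd_cons, ha, map_one, one_mul] at h1 h2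
        exact ⟨h1, g, h2⟩)
      simp at this
    match t with
    | [] =>
      refine (ha (hy g a.1 ?_)).elim
      simpa [act] using congrFun h2 1
    | ⟨s, b⟩ :: t =>
      refine ⟨a, ⟨s, b⟩, t, rfl, ha, Bool.eq_not.2 ?_⟩
      rintro rfl
      have := hmin (⟨a.1, a.2 * b⟩ :: t)
        (by
          simp only [listProd_cons, ← mul_assoc, ← map_mul] at h1 h2
          exact ⟨by simpa using h1, g, by simpa using h2⟩)
      simp at this

/-- Periodic sequences of labelled letters, with letters alternating between the two factors. -/
def rays (G : Bool → Type) [∀ s, Group (G s)] (L : Type) : Set (ℕ → (Σ s, G s) × L) :=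
  {r | (∃ N, 0 < N ∧ Function.Periodic r N) ∧ (∀ i, (r (i + 1)).1.1 = !(r i).1.1) ∧
    ∀ i, (r i).1.2 ≠ 1}

lemma countable_periodic (α : Type) [Countable α] :
    {r : ℕ → α | ∃ N, 0 < N ∧ Function.Periodic r N}.Countable := by
  refine (Set.countable_iUnion fun N : ℕ => Set.countable_range
    fun (f : Fin (N + 1) → α) (i : ℕ) => f (Fin.ofNat (N + 1) i)).mono ?_
  rintro r ⟨N, hN, hr⟩
  obtain ⟨N, rfl⟩ := Nat.exists_eq_add_one.2 hN
  exact Set.mem_iUnion.2 ⟨N, fun i => r i, funext fun i => hr.map_mod_nat i⟩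

lemma exists_ray {y : Monoid.CoprodI G → L} (hy : y ∈ regular G L) {g : Monoid.CoprodI G}
    (hg : g ≠ 1) (hgy : act g y = y) : ∃ r ∈ rays G L, ∃ i h, Carries r i (act h y) := by
  classical
  have hne : {l | Stabilizes y l}.Nonempty := by
    have : listProd (Word.equiv g).toList = g := Word.equiv.symm_apply_apply g
    exact ⟨_, by rwa [this], 1, by rwa [this, act_one]⟩
  set l := Function.argminOn List.length _ hne with hl
  have hls : Stabilizes y l := Function.argminOn_mem List.length _ hne
  have hmin : ∀ l', Stabilizes y l' → l.length ≤ l'.length := fun l' h =>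
    not_lt.1 (Function.not_lt_argminOn List.length _ h)
  have hred := fun i => (hls.rotate i).reduced hy (by simpa using hmin)
  have hpos : 0 < l.length := by
    obtain ⟨a, b, t, h, -⟩ := hred 0
    have := congrArg List.length h
    simp at this
    omega
  let x (i : ℕ) : Σ s, G s := l[i % l.length]'(Nat.mod_lt _ hpos)
  have hx : ∀ i, (x i).2 ≠ 1 ∧ (x (i + 1)).1 = !(x i).1 := fun i => by
    obtain ⟨a, b, t, h, h1, h2⟩ := hred i
    have ha : x i = a := by
      have := List.getElem_rotate l i 0 (by simp [hpos])
      simpa [h] using this.symm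
    have hb : x (i + 1) = b := by
      have := List.getElem_rotate l i 1 (by rw [h]; simp)
      simpa [h, add_comm 1 i] using this.symm
    rw [ha, hb]
    exact ⟨h1, h2⟩
  have hxp : Function.Periodic x l.length := fun i => by simp [x]
  obtain ⟨-, g', hg'⟩ := hls
  refine ⟨fun i => (x i, act g' y (path x 0 i)), ⟨⟨l.length, hpos, fun i => ?_⟩,
    fun i => (hx i).2, fun i => (hx i).1⟩, 0, g', fun k => by simp⟩
  have hpath : path x 0 l.length = listProd l :=
    path_eq_listProd x l 0 fun i hi => by simp [x, Nat.mod_eq_of_lt hi]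
  beta_reduce
  rw [hxp i, add_comm, path_add, path_periodic hxp, hpath]
  exact congrArg (Prod.mk (x i)) (congrFun hg' (path x 0 i))

/-- The regular points with trivial stabilizer. -/
def good (G : Bool → Type) [∀ s, Group (G s)] (L : Type) : Set (Monoid.CoprodI G → L) :=
  {y | y ∈ regular G L ∧ ∀ g, g ≠ 1 → act g y ≠ y}

lemma absorbed_compl_good [MeasurableSpace L] [MeasurableSingletonClass L] [Countable L]
    [∀ s, Countable (G s)] : Absorbed (good G L)ᶜ := by
  have : Countable (rays G L) := ((countable_periodic _).mono fun r hr => hr.1).to_subtype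
  obtain ⟨Z', hZ, h⟩ := Absorbed.iUnion (ι := Option (rays G L)) (Z := fun o => o.elim
    (regular G L)ᶜ fun r => {y | ∃ i g, Carries r.1 i (act g y)}) (by
      rintro (_ | ⟨r, hr⟩)
      · exact absorbed_compl_regular
      · exact absorbed_carries r hr.2.1 hr.2.2)
  refine ⟨Z', fun y hy => hZ ?_, h⟩
  by_cases hreg : y ∈ regular G L
  · simp only [good, Set.mem_compl_iff, Set.mem_ofPred_eq, hreg, true_and, not_forall,
      not_not] at hy
    obtain ⟨g, hg, hgy⟩ := hy
    obtain ⟨r, hr, h⟩ := exists_ray hreg hg hgy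
    exact Set.mem_iUnion.2 ⟨some ⟨r, hr⟩, h⟩
  · exact Set.mem_iUnion.2 ⟨none, hreg⟩

theorem not_solved_good [∀ s, Finite (G s)] [Finite L] [MeasurableSpace L]
    [MeasurableSingletonClass L]
    (hcard : Nat.card (G true) + Nat.card (G false) ≤ Nat.card L + 1) : ¬ Solved (good G L) := by
  rintro ⟨B, hB, h⟩
  obtain ⟨Z, hZ, hinv, hm, B', hB', h'⟩ := absorbed_compl_good (G := G) (L := L)
  have := Solved.iUnion (Z := fun b : Bool => cond b Z Zᶜ) (by
      rintro (_ | _)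
      · exact fun g y hy hy' => hy ((hinv.act_mem_iff g).1 hy')
      · exact hinv)
    (by
      rintro (_ | _)
      · exact hm.compl
      · exact hm)
    (by
      rintro (_ | _)
      · exact ⟨B, hB, fun y hy => h y (by_contra fun hy' => hy (hZ hy'))⟩
      · exact ⟨B', hB', h'⟩)
  obtain ⟨B, hB, h⟩ := this
  obtain ⟨y, hy⟩ := exists_not_solvedAt hcard hB
  exact hy (h y (by
    rw [← Set.union_eq_iUnion, Set.union_compl_self]
    trivial))

end FreeProd

/-- An acyclic bipartite Borel graph on `V` with a proper Borel edge coloring by `L`. -/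
structure ColoredGraph (V L : Type) [MeasurableSpace V] where
  rel : L → V → V → Prop
  symm : ∀ {a v w}, rel a v w → rel a w v
  unique : ∀ {a v w w'}, rel a v w → rel a v w' → w = w'
  label_unique : ∀ {a b v w}, rel a v w → rel b v w → a = b
  side : V → Bool
  measurable_side : Measurable side
  side_ne : ∀ {a v w}, rel a v w → side v ≠ side w
  measurableSet_rel : ∀ a, MeasurableSet {p : V × V | rel a p.1 p.2}
  exists_eq_of_periodic : ∀ (g : ℕ → V) (N : ℕ), 0 < N → Function.Periodic g N →
    (∀ i, ∃ a, rel a (g i) (g (i + 1))) → ∃ i, g i = g (i + 2)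

/-- The colors of the edges at the vertex `v`. -/
def ColoredGraph.colors {V L : Type} [MeasurableSpace V] (Γ : ColoredGraph V L) (v : V) : Set L :=
  {a | ∃ w, Γ.rel a v w}

namespace FreeProd

open Monoid.CoprodI

variable {G : Bool → Type} [∀ s, Group (G s)] {L : Type}

lemma invariant_good : Invariant (good G L) := by
  refine fun g y hy => ⟨fun h s => ?_, fun h hh he => ?_⟩
  · rw [act_act]
    exact hy.1 _ s
  · refine hy.2 (g * h * g⁻¹) (by simpa using hh) ?_
    have := congrArg (act g⁻¹) he
    simpa [act_act] using this

lemma good_rainbow {y : Monoid.CoprodI G → L} (hy : y ∈ good G L) (s : Bool) : Rainbow s y := by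
  simpa using hy.1 1 s

lemma good_act_inj {y : Monoid.CoprodI G → L} (hy : y ∈ good G L) {g h : Monoid.CoprodI G}
    (he : act g y = act h y) : g = h := by
  by_contra hne
  refine hy.2 (g * h⁻¹) (fun h' => hne (mul_inv_eq_one.1 h')) ?_
  rw [← act_act, he, act_act, mul_inv_cancel, act_one]

lemma front_of (s : Bool) (γ : G s) : front (of γ : Monoid.CoprodI G) ≠ some (!s) := by
  by_cases hγ : γ = 1
  · simp [hγ]
  · have := front_of_mul hγ (w := 1) (by simp)
    rw [mul_one] at this
    simp [this]

lemma of_eq_of {s s' : Bool} (hs : s ≠ s') {γ : G s} {δ : G s'}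
    (h : (of γ : Monoid.CoprodI G) = of δ) : γ = 1 ∧ δ = 1 := by
  obtain rfl : s' = !s := by simpa [Bool.eq_not] using hs.symm
  have h1 := front_of s γ
  have h2 := front_of (!s) δ
  rw [← h, Bool.not_not] at h2
  have h3 : (of γ : Monoid.CoprodI G) = 1 := eq_one_of_front (by
    by_contra h4
    obtain ⟨t, ht⟩ := Option.ne_none_iff_exists'.1 h4
    rw [ht] at h1 h2
    cases s <;> cases t <;> simp_all)
  exact ⟨of_injective s (by rw [h3, map_one]), of_injective (!s) (by rw [← h, h3, map_one])⟩

lemma front_path {x : ℕ → Σ s, G s} (hne : ∀ i, (x i).2 ≠ 1)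
    (hside : ∀ i, (x i).1 ≠ (x (i + 1)).1) (i k : ℕ) :
    front (path x i (k + 1)) = some (x i).1 := by
  rw [path]
  refine front_of_mul (hne i) ?_
  cases k with
  | zero => simp [path]
  | succ k =>
    rw [front_path hne hside (i + 1) k]
    simpa using (hside i).symm

variable [LinearOrder L]

/-- The label of the identity is the smallest one on the coset `G s`. -/
def MinLabel (s : Bool) (y : Monoid.CoprodI G → L) : Prop := ∀ γ : G s, y 1 ≤ y (of γ)

lemma MinLabel.eq {s : Bool} {y y' : Monoid.CoprodI G → L} (hy : y ∈ good G L)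
    (h : MinLabel s y) (h' : MinLabel s y') {γ γ' : G s} (he : act (of γ) y = act (of γ') y') :
    y = y' := by
  have h1 : act (of (γ * γ'⁻¹)) y = y' := by
    rw [← act_of_act_of, he, act_of_act_of, mul_inv_cancel, map_one, act_one]
  have h2 : y (of (γ * γ'⁻¹)) = y' 1 := by rw [← h1]; simp [act]
  have h3 : y' (of (γ * γ'⁻¹)⁻¹) = y 1 := by rw [← h1]; simp [act]
  have h4 : y (of (γ * γ'⁻¹)) = y (of (1 : G s)) := by
    rw [map_one]
    exact le_antisymm (by rw [h2, ← h3]; exact h' _) (h _)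
  rw [← h1, good_rainbow hy s h4, map_one, act_one]

lemma exists_minLabel [∀ s, Finite (G s)] (s : Bool) (y : Monoid.CoprodI G → L) :
    ∃ γ : G s, MinLabel s (act (of γ) y) := by
  obtain ⟨γ, hγ⟩ := Finite.exists_min fun γ : G s => y (of γ)
  exact ⟨γ, fun δ => by simpa [act, ← map_mul] using hγ (γ * δ)⟩

/-- The cosets of the two factors in the good part, represented by the point with the smallest
label. -/
abbrev Coset (G : Bool → Type) [∀ s, Group (G s)] (L : Type) [LinearOrder L] : Type :=
  {v : Bool × (Monoid.CoprodI G → L) // v.2 ∈ good G L ∧ MinLabel v.1 v.2}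

/-- Two cosets of different factors are joined by an edge colored `a` if they intersect in a point
labelled `a`. -/
def cosetRel (a : L) (v w : Coset G L) : Prop :=
  ∃ (s t : Bool) (γ : G s) (δ : G t), s ≠ t ∧ v.1.1 = s ∧ w.1.1 = t ∧
    act (of γ) v.1.2 = act (of δ) w.1.2 ∧ v.1.2 (of γ) = a

lemma cosetRel.symm {a : L} {v w : Coset G L} (h : cosetRel a v w) : cosetRel a w v := by
  obtain ⟨s, t, γ, δ, hst, hv, hw, he, ha⟩ := h
  refine ⟨t, s, δ, γ, hst.symm, hw, hv, he.symm, ?_⟩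
  have := congrFun he 1
  simp only [act, mul_one] at this
  rw [← this, ha]

lemma Coset.ext_of_act {v w : Coset G L} {s : Bool} (hv : v.1.1 = s) (hw : w.1.1 = s)
    {γ δ : G s} (he : act (of γ) v.1.2 = act (of δ) w.1.2) : v = w := by
  obtain ⟨⟨s', y⟩, hy⟩ := v
  obtain ⟨⟨s'', y'⟩, hy'⟩ := w
  subst hv
  obtain rfl : s'' = s' := hw
  obtain rfl := MinLabel.eq hy.1 hy.2 hy'.2 he
  rfl

lemma cosetRel.unique {a : L} {v w w' : Coset G L} (h : cosetRel a v w) (h' : cosetRel a v w') :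
    w = w' := by
  obtain ⟨s, t, γ, δ, hst, hv, hw, he, ha⟩ := h
  obtain ⟨s', t', γ', δ', hst', hv', hw', he', ha'⟩ := h'
  obtain rfl : s = s' := hv.symm.trans hv'
  obtain rfl : t = t' := by cases s <;> cases t <;> cases t' <;> simp_all
  obtain rfl : γ = γ' := good_rainbow v.2.1 s (ha.trans ha'.symm)
  exact Coset.ext_of_act hw hw' (he.symm.trans he')

lemma cosetRel.label_unique {a b : L} {v w : Coset G L} (h : cosetRel a v w)
    (h' : cosetRel b v w) : a = b := by
  obtain ⟨s, t, γ, δ, hst, hv, hw, he, ha⟩ := h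
  obtain ⟨s', t', γ', δ', hst', hv', hw', he', ha'⟩ := h'
  obtain rfl : s = s' := hv.symm.trans hv'
  obtain rfl : t = t' := hw.symm.trans hw'
  have h1 : act (of γ * of δ⁻¹) v.1.2 = act (of γ' * of δ'⁻¹) v.1.2 := by
    rw [← act_act, ← act_act, he, he']
    simp [act_act]
  have h2 := good_act_inj v.2.1 h1
  have h3 : (of (γ'⁻¹ * γ) : Monoid.CoprodI G) = of (δ'⁻¹ * δ) := by
    simp only [map_mul, map_inv] at h2 ⊢
    rw [inv_mul_eq_iff_eq_mul, ← mul_assoc, ← h2, inv_mul_cancel_right]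
  have h4 := inv_mul_eq_one.1 (of_eq_of hst h3).1
  rw [← ha, ← ha', h4]

lemma exists_cosetRel_iff [∀ s, Finite (G s)] {a : L} {v : Coset G L} :
    (∃ w, cosetRel a v w) ↔ ∃ γ : G v.1.1, v.1.2 (of γ) = a := by
  constructor
  · rintro ⟨w, s, t, γ, δ, -, rfl, -, -, ha⟩
    exact ⟨γ, ha⟩
  · rintro ⟨γ, ha⟩
    obtain ⟨δ, hδ⟩ := exists_minLabel (!v.1.1) (act (of γ) v.1.2)
    refine ⟨⟨(!v.1.1, act (of δ) (act (of γ) v.1.2)),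
      invariant_good _ _ (invariant_good _ _ v.2.1), hδ⟩, v.1.1, !v.1.1, γ, δ⁻¹, by simp, rfl, rfl, ?_, ha⟩
    rw [act_of_act_of, mul_inv_cancel, map_one, act_one]

lemma cosetRel_exists_eq_of_periodic (g : ℕ → Coset G L) (N : ℕ) (hN : 0 < N)
    (hg : Function.Periodic g N) (h : ∀ i, ∃ a, cosetRel a (g i) (g (i + 1))) :
    ∃ i, g i = g (i + 2) := by
  by_contra! hne
  have h' : ∀ i, ∃ (γ : G (g i).1.1) (δ : G (g (i + 1)).1.1), (g i).1.1 ≠ (g (i + 1)).1.1 ∧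
      act (of γ) (g i).1.2 = act (of δ) (g (i + 1)).1.2 := by
    intro i
    obtain ⟨a, s, t, γ, δ, hst, rfl, rfl, he, -⟩ := h i
    exact ⟨γ, δ, hst, he⟩
  choose γ δ hside he using h'
  let x (i : ℕ) : Σ s, G s := ⟨(g (i + 1)).1.1, (δ i)⁻¹ * γ (i + 1)⟩
  have hx : ∀ i, (x i).2 ≠ 1 := fun i hi => by
    have h1 : δ i = γ (i + 1) := inv_mul_eq_one.1 hi
    have h2 := he i
    rw [h1, he (i + 1)] at h2
    have h3 : (g (i + 2)).1.1 = (g i).1.1 := by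
      have := hside i
      have := hside (i + 1)
      cases h : (g i).1.1 <;> cases h' : (g (i + 1)).1.1 <;> cases h'' : (g (i + 1 + 1)).1.1 <;>
        simp_all
    obtain ⟨δ', hδ'⟩ : ∃ δ' : G (g i).1.1, act (of (δ (i + 1))) (g (i + 1 + 1)).1.2 =
        act (of δ') (g (i + 2)).1.2 := by
      rw [← h3]; exact ⟨_, rfl⟩
    exact hne i (Coset.ext_of_act rfl h3 (h2.trans hδ'))
  have hpath : ∀ k, act (of (γ k)) (g k).1.2 = act (of (γ 0) * path x 0 k) (g 0).1.2 := by
    intro k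
    induction k with
    | zero => simp [path]
    | succ k ih =>
      rw [path_add, ← mul_assoc, ← act_act, ← ih, he k, act_act, zero_add]
      simp [path, x]
  have h1 := hpath N
  obtain ⟨γ', hγ'⟩ : ∃ γ' : G (g 0).1.1, act (of (γ N)) (g N).1.2 = act (of γ') (g 0).1.2 := by
    have hg0 : g N = g 0 := by simpa using hg 0
    rw [← hg0]; exact ⟨_, rfl⟩
  rw [hγ'] at h1
  have h2 := good_act_inj (g 0).2.1 h1
  obtain ⟨N, rfl⟩ := Nat.exists_eq_add_one.2 hN
  have h3 := front_path hx (fun i => hside (i + 1)) 0 N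
  have h4 : path x 0 (N + 1) = of ((γ 0)⁻¹ * γ') := by rw [map_mul, h2]; simp
  rw [h4] at h3
  have h5 := front_of _ ((γ 0)⁻¹ * γ')
  rw [h3] at h5
  exact h5 (congrArg some (Bool.eq_not.2 (hside 0).symm))

end FreeProd

namespace FreeProd

open Monoid.CoprodI

variable {G : Bool → Type} [∀ s, Group (G s)] {L : Type}

lemma countable_coprodI [∀ s, Countable (G s)] : Countable (Monoid.CoprodI G) := by
  classical
  have h : Function.Injective (Word.toList (M := G)) := fun _ _ => Word.ext
  have := h.countable
  exact (Word.equiv (M := G)).injective.countable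

variable [MeasurableSpace L]

lemma measurableSet_good [MeasurableSingletonClass L] [Countable L] [∀ s, Countable (G s)] :
    MeasurableSet (good G L) := by
  have := countable_coprodI (G := G)
  have h1 : MeasurableSet (regular G L) := by
    simp only [regular, Set.ofPred_forall]
    exact .iInter fun g => .iInter fun s => (measurable_act g) (measurableSet_rainbow s)
  refine h1.inter ?_
  have h2 : MeasurableSet (⋂ (g : Monoid.CoprodI G) (_ : g ≠ 1),
      {y : Monoid.CoprodI G → L | act g y = y}ᶜ) :=
    .iInter fun g => .iInter fun _ =>
    (measurableSet_eq_fun (measurable_act g) measurable_id).compl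
  refine (congrArg MeasurableSet (Set.ext fun y => ?_)).mp h2
  change _ ↔ ∀ g, g ≠ 1 → act g y ≠ y
  simp

variable [LinearOrder L]

lemma measurableSet_minLabel [MeasurableSingletonClass L] [Countable L] [∀ s, Countable (G s)]
    (s : Bool) : MeasurableSet {y : Monoid.CoprodI G → L | MinLabel s y} := by
  simp only [MinLabel, Set.ofPred_forall]
  refine .iInter fun γ => ?_
  have h : Measurable fun y : Monoid.CoprodI G → L => (y 1, y (of γ)) :=
    (measurable_pi_apply _).prodMk (measurable_pi_apply _)
  exact h (MeasurableSet.of_discrete (s := {p : L × L | p.1 ≤ p.2}))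

lemma measurableSet_coset [MeasurableSingletonClass L] [Countable L] [∀ s, Countable (G s)] :
    MeasurableSet {v : Bool × (Monoid.CoprodI G → L) | v.2 ∈ good G L ∧ MinLabel v.1 v.2} := by
  refine (measurable_snd measurableSet_good).inter ?_
  have h : {v : Bool × (Monoid.CoprodI G → L) | MinLabel v.1 v.2} =
      ⋃ s, {v | v.1 = s} ∩ {v | MinLabel s v.2} := by
    ext v
    simp
  change MeasurableSet {v : Bool × (Monoid.CoprodI G → L) | MinLabel v.1 v.2}
  rw [h]
  exact .iUnion fun s => (measurable_fst (measurableSet_singleton s)).inter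
    (measurable_snd (measurableSet_minLabel s))

instance [MeasurableSingletonClass L] [Countable L] [∀ s, Countable (G s)] :
    StandardBorelSpace (Coset G L) := by
  have := countable_coprodI (G := G)
  exact measurableSet_coset.standardBorel

lemma measurable_label (g : Monoid.CoprodI G) : Measurable fun v : Coset G L => v.1.2 g :=
  (measurable_pi_apply g).comp (measurable_snd.comp measurable_subtype_coe)

lemma measurableSet_cosetRel [MeasurableSingletonClass L] [Countable L] [∀ s, Countable (G s)]
    (a : L) : MeasurableSet {p : Coset G L × Coset G L | cosetRel a p.1 p.2} := by
  have := countable_coprodI (G := G)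
  have hside : Measurable fun v : Coset G L => v.1.1 := measurable_fst.comp measurable_subtype_coe
  have hpt : Measurable fun v : Coset G L => v.1.2 := measurable_snd.comp measurable_subtype_coe
  simp only [cosetRel, Set.ofPred_exists, Set.ofPred_and]
  refine .iUnion fun s => .iUnion fun t => .iUnion fun γ => .iUnion fun δ =>
    (MeasurableSet.const _).inter (.inter ?_ (.inter ?_ (.inter ?_ ?_)))
  · exact hside.comp measurable_fst (measurableSet_singleton s)
  · exact hside.comp measurable_snd (measurableSet_singleton t)
  · exact measurableSet_eq_fun ((measurable_act _).comp (hpt.comp measurable_fst))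
      ((measurable_act _).comp (hpt.comp measurable_snd))
  · exact (measurable_label (of γ)).comp measurable_fst (measurableSet_singleton a)

/-- The intersection graph of the cosets. -/
def cosetGraph (G : Bool → Type) [∀ s, Group (G s)] [∀ s, Countable (G s)] (L : Type)
    [LinearOrder L] [Countable L] [MeasurableSpace L] [MeasurableSingletonClass L] :
    ColoredGraph (Coset G L) L where
  rel := cosetRel
  symm := cosetRel.symm
  unique := cosetRel.unique
  label_unique := cosetRel.label_unique
  side v := v.1.1
  measurable_side := measurable_fst.comp measurable_subtype_coe
  side_ne := by
    rintro a v w ⟨s, t, γ, δ, hst, hv, hw, -⟩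
    rwa [hv, hw]
  measurableSet_rel := measurableSet_cosetRel
  exists_eq_of_periodic := cosetRel_exists_eq_of_periodic

section

variable [∀ s, Finite (G s)] [MeasurableSingletonClass L]

lemma colors_cosetGraph [Countable L] (v : Coset G L) :
    (cosetGraph G L).colors v = Set.range fun γ : G v.1.1 => v.1.2 (of γ) :=
  Set.ext fun _ => exists_cosetRel_iff

lemma ncard_colors_cosetGraph [Countable L] (v : Coset G L) :
    ((cosetGraph G L).colors v).ncard = Nat.card (G v.1.1) := by
  rw [colors_cosetGraph, ← Nat.card_coe_set_eq]
  exact Nat.card_range_of_injective (good_rainbow v.2.1 _)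

lemma measurableSet_mem_colors_cosetGraph [Countable L] (a : L) :
    MeasurableSet {v | a ∈ (cosetGraph G L).colors v} := by
  have h : {v | a ∈ (cosetGraph G L).colors v} =
      ⋃ s, {v : Coset G L | v.1.1 = s} ∩ ⋃ γ : G s, {v | v.1.2 (of γ) = a} := by
    ext v
    simp [colors_cosetGraph]
  rw [h]
  exact .iUnion fun s =>
    ((measurable_fst.comp measurable_subtype_coe) (measurableSet_singleton s)).inter
      (.iUnion fun γ => measurable_label (of γ) (measurableSet_singleton a))

theorem card_le_of_cosetGraph_coloring [Finite L]
    (hcard : Nat.card (G true) + Nat.card (G false) = Nat.card L + 1) {Y : Type} [Finite Y]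
    [MeasurableSpace Y] [DiscreteMeasurableSpace Y] {c : Coset G L × Coset G L → Y}
    (hc : Measurable c) (hsymm : ∀ a v w, cosetRel a v w → c (v, w) = c (w, v))
    (hproper : ∀ a b v w w', cosetRel a v w → cosetRel b v w' → w ≠ w' → c (v, w) ≠ c (v, w')) :
    Nat.card L ≤ Nat.card Y := by
  classical
  by_contra! hlt
  have hpos (s) : 0 < Nat.card (G s) := Nat.card_pos
  obtain ⟨S, -, hS⟩ := Set.exists_subset_card_eq (s := (Set.univ : Set Y))
    (n := min (Nat.card Y) (Nat.card (G true) - 1)) (by simp [Set.ncard_univ])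
  have hS' : Sᶜ.ncard < Nat.card (G false) := by
    have := Set.ncard_add_ncard_compl S
    have := hpos false
    omega
  have hS : S.ncard < Nat.card (G true) := by have := hpos true; omega
  choose γ hγ using fun s (y : good G L) => exists_minLabel s y.1
  let rep (s : Bool) (y : good G L) : Coset G L :=
    ⟨(s, act (of (γ s y)) y.1), invariant_good _ _ y.2, hγ s y⟩
  have hrep (s) : Measurable (rep s) := by
    let _ : MeasurableSpace (G s) := ⊤
    have h1 : Measurable (γ s) := by
      refine measurable_to_countable' fun δ => ?_
      have h2 : γ s ⁻¹' {δ} = {y : good G L | MinLabel s (act (of δ) y.1)} := by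
        ext y
        refine ⟨?_, fun h => ?_⟩
        · rintro rfl
          exact hγ s y
        · have h3 : act (of (γ s y)) y.1 = act (of δ) y.1 := by
            refine MinLabel.eq (γ := (γ s y)⁻¹) (γ' := δ⁻¹) (invariant_good _ _ y.2) (hγ s y) h ?_
            simp [act_act, act_one]
          exact of_injective s (good_act_inj y.2 h3)
      rw [h2]
      exact ((measurable_act _).comp measurable_subtype_coe) (measurableSet_minLabel s)
    have h2 : Measurable fun p : good G L × G s => act (of p.2) p.1.1 :=
      measurable_from_prod_countable_left fun δ =>
        (measurable_act (of δ)).comp measurable_subtype_coe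
    exact (measurable_const.prodMk (h2.comp (measurable_id.prodMk h1))).subtype_mk
  have hedge (s) (y : good G L) : cosetRel (y.1 1) (rep s y) (rep (!s) y) := by
    refine ⟨s, !s, (γ s y)⁻¹, (γ (!s) y)⁻¹, by simp, rfl, rfl, ?_, ?_⟩
    · simp [rep, act_act, act_one]
    · simp [rep, act]
  let e (y : good G L) : Y := c (rep true y, rep false y)
  have he (s) (y) : e y = c (rep s y, rep (!s) y) := by
    cases s
    · exact hsymm _ _ _ (hedge true y)
    · rfl
  have hinj (s) (y : good G L) :
      Function.Injective fun δ : G s => e ⟨act (of δ) y.1, invariant_good _ _ y.2⟩ := by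
    intro δ δ' h
    have h1 (δ : G s) : rep s ⟨act (of δ) y.1, invariant_good _ _ y.2⟩ = rep s y := by
      refine Coset.ext_of_act (s := s) rfl rfl
        (γ := (γ s ⟨act (of δ) y.1, invariant_good _ _ y.2⟩)⁻¹ * δ⁻¹) (δ := (γ s y)⁻¹) ?_
      simp [rep, act_act, act_one, mul_assoc]
    have h2 (δ : G s) := hedge s ⟨act (of δ) y.1, invariant_good _ _ y.2⟩
    simp only [he s, h1] at h h2
    by_contra hne
    refine hproper _ _ _ _ _ (h2 δ) (h2 δ') (fun h3 => hne ?_) h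
    have h4 := (h2 δ').label_unique (h3 ▸ h2 δ)
    simp only [act, mul_one] at h4
    exact (good_rainbow y.2 s h4).symm
  have hB : MeasurableSet (e ⁻¹' S) :=
    (hc.comp ((hrep true).prodMk (hrep false))) MeasurableSet.of_discrete
  refine not_solved_good (G := G) (L := L) hcard.le
    ⟨Subtype.val '' (e ⁻¹' S), measurableSet_good.subtype_image hB, fun y hy s _ => ?_⟩
  have hmem (δ : G s) : act (of δ) y ∈ Subtype.val '' (e ⁻¹' S) ↔
      e ⟨act (of δ) y, invariant_good _ _ hy⟩ ∈ S := by
    simp [invariant_good _ _ hy]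
  simp only [hmem]
  by_contra! h
  have key (T : Set Y) (hT : ∀ δ : G s, e ⟨act (of δ) y, invariant_good _ _ hy⟩ ∈ T) :
      Nat.card (G s) ≤ T.ncard := by
    rw [← Nat.card_coe_set_eq]
    exact Nat.card_le_card_of_injective (fun δ : G s => (⟨_, hT δ⟩ : T)) fun δ δ' hδ =>
      hinj s ⟨y, hy⟩ (congrArg Subtype.val hδ)
  cases s
  · exact hS'.not_ge (key Sᶜ fun δ => by simpa using h δ)
  · exact hS.not_ge (key S fun δ => by simpa using h δ)

end

end FreeProd

/-- Finite sequences of colors carry the discrete Borel structure. -/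
instance discreteMeasurableSpaceList (L : Type) : MeasurableSpace (List L) := ⊤

instance (L : Type) : DiscreteMeasurableSpace (List L) := ⟨fun _ => trivial⟩

namespace ColoredGraph

variable {V L : Type} [MeasurableSpace V] (Γ : ColoredGraph V L) (X : Set L → Set L)

/-- The colors already used at the last vertex of the branch `q` attached to `v`. -/
def used (v : V) : List L → Set L
  | [] => Γ.colors v
  | a :: _ => {a}

/-- The branch `q` is one of those attached to `v`, if `X O` is the set of colors added at a vertex
at which the colors in `O` are used. -/
def IsBranch (v : V) : List L → Prop
  | [] => True
  | a :: q => a ∈ X (Γ.used v q) ∧ IsBranch v q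

/-- The vertices obtained by attaching trees to the vertices of `Γ`. -/
abbrev Graft : Type := {p : V × List L // Γ.IsBranch X p.1 p.2}

/-- The colored edges obtained by attaching trees to the vertices of `Γ`. -/
def graftRel (a : L) (x y : Γ.Graft X) : Prop :=
  (x.1.2 = [] ∧ y.1.2 = [] ∧ Γ.rel a x.1.1 y.1.1) ∨
    x.1.1 = y.1.1 ∧ (y.1.2 = a :: x.1.2 ∨ x.1.2 = a :: y.1.2)

variable {Γ X}

lemma graftRel.symm {a : L} {x y : Γ.Graft X} (h : Γ.graftRel X a x y) : Γ.graftRel X a y x := by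
  rcases h with ⟨h1, h2, h⟩ | ⟨h, h'⟩
  · exact .inl ⟨h2, h1, Γ.symm h⟩
  · exact .inr ⟨h.symm, h'.symm⟩

lemma graftRel.unique (hX : ∀ O, X O ⊆ Oᶜ) {a : L} {x y z : Γ.Graft X} (h : Γ.graftRel X a x y)
    (h' : Γ.graftRel X a x z) : y = z := by
  obtain ⟨⟨v, q⟩, hq⟩ := x
  obtain ⟨⟨v', q'⟩, hq'⟩ := y
  obtain ⟨⟨v'', q''⟩, hq''⟩ := z
  simp only [graftRel] at h h'
  rcases h with ⟨rfl, rfl, h⟩ | ⟨rfl, rfl | rfl⟩ <;>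
    rcases h' with ⟨h1, h2, h'⟩ | ⟨rfl, h' | h'⟩
  · subst h2
    obtain rfl := Γ.unique h h'
    rfl
  · subst h'
    exact (hX _ hq''.1 ⟨_, h⟩).elim
  · simp at h'
  · subst h1
    exact (hX _ hq'.1 ⟨_, h'⟩).elim
  · subst h'
    rfl
  · subst h'
    exact (hX _ hq'.1 rfl).elim
  · simp at h1
  · subst h'
    exact (hX _ hq''.1 rfl).elim
  · obtain rfl := List.tail_eq_of_cons_eq h'
    rfl

lemma graftRel.label_unique {a b : L} {x y : Γ.Graft X} (h : Γ.graftRel X a x y)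
    (h' : Γ.graftRel X b x y) : a = b := by
  have hne (c d : L) (q : List L) : q ≠ c :: d :: q := fun h => by
    have := congrArg List.length h
    simp only [List.length_cons] at this
    lia
  rcases h with ⟨h1, h2, h⟩ | ⟨-, h | h⟩ <;> rcases h' with ⟨h1', h2', h'⟩ | ⟨-, h' | h'⟩
  · exact Γ.label_unique h h'
  all_goals grind

lemma graftRel_exists_eq_of_periodic (g : ℕ → Γ.Graft X) (N : ℕ) (hN : 0 < N)
    (hg : Function.Periodic g N) (h : ∀ i, ∃ a, Γ.graftRel X a (g i) (g (i + 1))) :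
    ∃ i, g i = g (i + 2) := by
  obtain ⟨k, -, hk⟩ := (Finset.range N).exists_max_image (fun i => (g i).1.2.length)
    ⟨0, by simpa using hN⟩
  have hmax (i) : (g i).1.2.length ≤ (g (k + N)).1.2.length := by
    rw [hg k, ← hg.map_mod_nat i]
    exact hk _ (by simpa using Nat.mod_lt _ hN)
  obtain ⟨N, rfl⟩ := Nat.exists_eq_add_one.2 hN
  rw [← add_assoc] at hmax
  cases hq : (g (k + N + 1)).1.2 with
  | nil =>
    have h0 (i) : (g i).1.2 = [] := by simpa [hq] using hmax i
    obtain ⟨i, hi⟩ := Γ.exists_eq_of_periodic (fun i => (g i).1.1) (N + 1) hN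
      (fun i => by simp only [hg i]) fun i => by
        obtain ⟨a, ha⟩ := h i
        exact ⟨a, by simpa [graftRel, h0] using ha⟩
    exact ⟨i, Subtype.ext (Prod.ext hi (by rw [h0, h0]))⟩
  | cons a q =>
    have key {b : L} {y : Γ.Graft X} (hb : Γ.graftRel X b (g (k + N + 1)) y)
        (hy : y.1.2.length ≤ (g (k + N + 1)).1.2.length) : y.1 = ((g (k + N + 1)).1.1, q) := by
      rcases hb with ⟨h1, -⟩ | ⟨h1, h2 | h2⟩
      · simp [hq] at h1
      · simp [h2] at hy
      · rw [hq] at h2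
        exact Prod.ext h1.symm (List.tail_eq_of_cons_eq h2).symm
    obtain ⟨b, hb⟩ := h (k + N)
    obtain ⟨b', hb'⟩ := h (k + N + 1)
    exact ⟨k + N, Subtype.ext ((key hb.symm (hmax _)).trans (key hb' (hmax _)).symm)⟩

lemma colors_graft (x : Γ.Graft X) :
    {a | ∃ y, Γ.graftRel X a x y} = Γ.used x.1.1 x.1.2 ∪ X (Γ.used x.1.1 x.1.2) := by
  obtain ⟨⟨v, q⟩, hq⟩ := x
  ext a
  constructor
  · rintro ⟨⟨⟨v', q'⟩, hq'⟩, ⟨rfl, -, h⟩ | ⟨rfl, rfl | h⟩⟩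
    · exact .inl ⟨v', h⟩
    · exact .inr hq'.1
    · obtain rfl : q = a :: q' := h
      exact .inl rfl
  · rintro (h | h)
    · cases q with
      | nil =>
        obtain ⟨w, hw⟩ := h
        exact ⟨⟨(w, []), trivial⟩, .inl ⟨rfl, rfl, hw⟩⟩
      | cons b q =>
        obtain rfl : a = b := h
        exact ⟨⟨(v, q), hq.2⟩, .inr ⟨rfl, .inr rfl⟩⟩
    · exact ⟨⟨(v, a :: q), h, hq⟩, .inr ⟨rfl, .inl rfl⟩⟩

lemma measurableSet_isBranch [Finite L] (hm : ∀ a, MeasurableSet {v | a ∈ Γ.colors v}) :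
    MeasurableSet {p : V × List L | Γ.IsBranch X p.1 p.2} := by
  have h1 (O : Set L) : MeasurableSet {v | Γ.colors v = O} := by
    simp only [Set.ext_iff, Set.ofPred_forall]
    refine .iInter fun a => ?_
    by_cases ha : a ∈ O
    · simpa [ha] using hm a
    · simp only [ha, iff_false]
      exact (hm a).compl
  have h2 (a : L) (q : List L) : MeasurableSet {v | a ∈ X (Γ.used v q)} := by
    cases q with
    | nil =>
      have h3 : {v | a ∈ X (Γ.colors v)} = ⋃ (O : Set L) (_ : a ∈ X O), {v | Γ.colors v = O} := by
        ext v
        simp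
      exact h3 ▸ .iUnion fun O => .iUnion fun _ => h1 O
    | cons b q => exact .const (a ∈ X {b})
  have h4 (q : List L) : MeasurableSet {v | Γ.IsBranch X v q} := by
    induction q with
    | nil => exact .const _
    | cons a q ih => exact (h2 a q).inter ih
  have h5 : {p : V × List L | Γ.IsBranch X p.1 p.2} =
      ⋃ q, {v | Γ.IsBranch X v q} ×ˢ {q} := by
    ext p
    simp
  exact h5 ▸ .iUnion fun q => (h4 q).prod (.of_discrete)

/-- The graph obtained by attaching trees to the vertices of `Γ`. -/
def graft [MeasurableEq V] [Countable L] (Γ : ColoredGraph V L) (X : Set L → Set L)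
    (hX : ∀ O, X O ⊆ Oᶜ) : ColoredGraph (Γ.Graft X) L where
  rel := Γ.graftRel X
  symm := graftRel.symm
  unique := graftRel.unique hX
  label_unique := graftRel.label_unique
  side x := Γ.side x.1.1 ^^ x.1.2.length.bodd
  measurable_side := by
    have h : Measurable fun p : Bool × ℕ => p.1 ^^ p.2.bodd := .of_discrete
    exact h.comp ((Γ.measurable_side.comp (measurable_fst.comp measurable_subtype_coe)).prodMk
      (Measurable.of_discrete.comp (measurable_snd.comp measurable_subtype_coe)))
  side_ne := by
    rintro a x y (⟨h1, h2, h⟩ | ⟨h, h' | h'⟩)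
    · simpa [h1, h2] using Γ.side_ne h
    · simp [h, h']
    · simp [h, h']
  measurableSet_rel a := by
    have hv : Measurable fun x : Γ.Graft X => x.1.1 := measurable_fst.comp measurable_subtype_coe
    have hq : Measurable fun x : Γ.Graft X => x.1.2 := measurable_snd.comp measurable_subtype_coe
    have hv2 := (hv.comp measurable_fst).prodMk (hv.comp measurable_snd)
    have hq2 := (hq.comp measurable_fst).prodMk (hq.comp measurable_snd)
    refine ((hq2 (MeasurableSet.of_discrete (s := {p | p.1 = []}))).inter
      ((hq2 (MeasurableSet.of_discrete (s := {p | p.2 = []}))).inter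
        (hv2 (Γ.measurableSet_rel a)))).union ((hv2 measurableSet_diagonal).inter
      (hq2 (MeasurableSet.of_discrete (s := {p | p.2 = a :: p.1 ∨ p.1 = a :: p.2}))))
  exists_eq_of_periodic := graftRel_exists_eq_of_periodic

end ColoredGraph

namespace ColoredGraph

variable {V L : Type} [MeasurableSpace V] (Γ : ColoredGraph V L)

/-- The underlying uncolored graph. -/
def toSimpleGraph : SimpleGraph V where
  Adj v w := ∃ a, Γ.rel a v w
  symm := ⟨fun _ _ ⟨a, h⟩ => ⟨a, Γ.symm h⟩⟩
  loopless := ⟨fun _ ⟨_, h⟩ => Γ.side_ne h rfl⟩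

lemma measurableSet_adj [Countable L] :
    MeasurableSet {p : V × V | Γ.toSimpleGraph.Adj p.1 p.2} := by
  simp only [toSimpleGraph, Set.ofPred_exists]
  exact .iUnion Γ.measurableSet_rel

lemma encard_neighborSet (v : V) :
    (Γ.toSimpleGraph.neighborSet v).encard = (Γ.colors v).encard := by
  choose f hf using fun a : Γ.colors v => a.2
  have h : Γ.toSimpleGraph.neighborSet v = Set.range f := by
    ext w
    constructor
    · rintro ⟨a, h⟩
      exact ⟨⟨a, w, h⟩, Γ.unique (hf _) h⟩
    · rintro ⟨a, rfl⟩
      exact ⟨a, hf a⟩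
  have hinj : Function.Injective f := fun a b hab =>
    Subtype.ext (Γ.label_unique (hf a) (hab ▸ hf b))
  rw [h, ← Set.image_univ, hinj.encard_image, Set.encard_univ, Set.encard, ENat.card]

lemma isAcyclic_toSimpleGraph : Γ.toSimpleGraph.IsAcyclic := by
  intro v c hc
  have h3 := hc.three_le_length
  obtain ⟨i, hi⟩ := Γ.exists_eq_of_periodic (fun i => c.getVert (i % c.length)) c.length
    (by lia) (fun i => by simp) (fun i => by
      have hlt := Nat.mod_lt i (show 0 < c.length by lia)
      have h := c.adj_getVert_succ hlt
      rcases Nat.lt_or_ge (i % c.length + 1) c.length with h1 | h1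
      · rwa [Nat.add_mod, Nat.mod_eq_of_lt (show 1 < c.length by lia), Nat.mod_eq_of_lt h1]
      · have h2 : i % c.length + 1 = c.length := by lia
        rw [h2, c.getVert_length] at h
        rwa [Nat.add_mod, Nat.mod_eq_of_lt (show 1 < c.length by lia), h2, Nat.mod_self,
          c.getVert_zero])
  have hlt (j) := Nat.mod_lt j (show 0 < c.length by lia)
  have h := hc.getVert_injOn' (by have := hlt i; simp; lia) (by have := hlt (i + 2); simp; lia) hi
  have h4 : 0 ≡ 2 [MOD c.length] := Nat.ModEq.add_left_cancel' i h
  have h5 := Nat.le_of_dvd two_pos ((Nat.modEq_zero_iff_dvd).1 h4.symm)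
  lia

lemma exists_measurable_edgeColoring [Countable L] [Nonempty L] [MeasurableSpace L] :
    ∃ c : V × V → L, Measurable c ∧
      (∀ v w, Γ.toSimpleGraph.Adj v w → c (v, w) = c (w, v)) ∧
      (∀ v w w', Γ.toSimpleGraph.Adj v w → Γ.toSimpleGraph.Adj v w' → w ≠ w' →
        c (v, w) ≠ c (v, w')) := by
  classical
  let c (p : V × V) : L := if h : ∃ a, Γ.rel a p.1 p.2 then h.choose else Classical.arbitrary L
  have hc {a : L} {v w : V} (h : Γ.rel a v w) : c (v, w) = a := by
    have h1 : ∃ a, Γ.rel a v w := ⟨a, h⟩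
    simp only [c, h1, dite_true]
    exact Γ.label_unique h1.choose_spec h
  refine ⟨c, ?_, ?_, ?_⟩
  · refine measurable_to_countable' fun a => ?_
    by_cases ha : a = Classical.arbitrary L
    · have h1 : c ⁻¹' {a} = {p | Γ.rel a p.1 p.2} ∪ {p | Γ.toSimpleGraph.Adj p.1 p.2}ᶜ := by
        ext p
        by_cases h : ∃ b, Γ.rel b p.1 p.2
        · obtain ⟨b, h⟩ := h
          have h2 : c p = b := hc h
          have h3 : Γ.toSimpleGraph.Adj p.1 p.2 := ⟨b, h⟩
          simp only [Set.mem_preimage, Set.mem_singleton_iff, h2, Set.mem_union, Set.mem_ofPred_eq,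
            Set.mem_compl_iff, h3, not_true_eq_false, or_false]
          exact ⟨fun h4 => h4 ▸ h, fun h4 => Γ.label_unique h h4⟩
        · have h3 : ¬ Γ.toSimpleGraph.Adj p.1 p.2 := h
          simp [c, h, h3, ha]
      exact h1 ▸ (Γ.measurableSet_rel a).union Γ.measurableSet_adj.compl
    · have h1 : c ⁻¹' {a} = {p | Γ.rel a p.1 p.2} := by
        ext p
        refine ⟨fun h => ?_, fun h => hc h⟩
        by_cases h2 : ∃ b, Γ.rel b p.1 p.2
        · obtain ⟨b, h2⟩ := h2
          obtain rfl : b = a := (hc h2).symm.trans h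
          exact h2
        · refine (ha ?_).elim
          rw [← (h : c p = a)]
          simp [c, h2]
      exact h1 ▸ Γ.measurableSet_rel a
  · rintro v w ⟨a, h⟩
    rw [hc h, hc (Γ.symm h)]
  · rintro v w w' ⟨a, h⟩ ⟨b, h'⟩ hne he
    rw [hc h, hc h'] at he
    subst he
    exact hne (Γ.unique h h')

end ColoredGraph

/-- For every `n ≥ 1` and every `m ∈ {n, …, 2n−1}`, there is an `n`-regular acyclic Borel
bipartite graph `G` whose Borel edge chromatic number `χ'_B(G)` is exactly `m`. -/
theorem stmt_10 (n m : ℕ) (hn : 1 ≤ n) (hm1 : n ≤ m) (hm2 : m ≤ 2 * n - 1) :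
    ∃ (X : Type) (mX : MeasurableSpace X) (G : SimpleGraph X),
      @StandardBorelSpace X mX ∧
      @MeasurableSet (X × X) (@Prod.instMeasurableSpace X X mX mX)
        {p : X × X | G.Adj p.1 p.2} ∧
      (∀ x, (G.neighborSet x).encard = n) ∧
      G.IsAcyclic ∧
      (∃ A : Set X, @MeasurableSet X mX A ∧ ∀ x y, G.Adj x y → (x ∈ A ↔ y ∉ A)) ∧
      @borelEdgeChromaticNumber X mX G.Adj = (m : Cardinal) := by
  obtain ⟨d, rfl⟩ : ∃ d, m = n + d := Nat.exists_eq_add_of_le hm1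
  let G (s : Bool) : Type := Multiplicative (ZMod (if s then n else d + 1))
  let L := Fin (n + d)
  have hne (s : Bool) : NeZero (if s then n else d + 1) := ⟨by cases s <;> simp; lia⟩
  have (s : Bool) : Finite (G s) := inferInstanceAs (Finite (Multiplicative (ZMod _)))
  have hcardG (s : Bool) : Nat.card (G s) = if s then n else d + 1 := by
    simp [G]
  have hsum : Nat.card (G true) + Nat.card (G false) = Nat.card L + 1 := by
    rw [hcardG, hcardG, Nat.card_fin, if_pos rfl, if_neg Bool.false_ne_true, add_assoc]
  have hex (O : Set L) : ∃ E ⊆ Oᶜ, O.ncard ≤ n → E.ncard = n - O.ncard := by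
    by_cases hO : O.ncard ≤ n
    · obtain ⟨E, hE, h⟩ := Set.exists_subset_card_eq (s := Oᶜ) (n := n - O.ncard) (by
        have := Set.ncard_add_ncard_compl O
        simp only [L, Nat.card_fin] at this
        lia)
      exact ⟨E, hE, fun _ => h⟩
    · exact ⟨∅, by simp, fun h => (hO h).elim⟩
  choose X hX hXcard using hex
  let Γ := FreeProd.cosetGraph G L
  have hm : MeasurableSet {p : FreeProd.Coset G L × List L | Γ.IsBranch X p.1 p.2} :=
    ColoredGraph.measurableSet_isBranch FreeProd.measurableSet_mem_colors_cosetGraph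
  let Δ := Γ.graft X hX
  have hmem : ((n + d : ℕ) : Cardinal) ∈ {κ : Cardinal | ∃ (Y : Type) (mY : MeasurableSpace Y),
      @StandardBorelSpace Y mY ∧ Cardinal.mk Y = κ ∧ ∃ c : Γ.Graft X × Γ.Graft X → Y,
        Measurable c ∧ (∀ x y, Δ.toSimpleGraph.Adj x y → c (x, y) = c (y, x)) ∧
        (∀ x y z, Δ.toSimpleGraph.Adj x y → Δ.toSimpleGraph.Adj x z → y ≠ z →
          c (x, y) ≠ c (x, z))} := by
    have : Nonempty L := ⟨⟨0, by lia⟩⟩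
    exact ⟨L, inferInstance, inferInstance, Cardinal.mk_fin _, Δ.exists_measurable_edgeColoring⟩
  refine ⟨Γ.Graft X, inferInstance, Δ.toSimpleGraph, hm.standardBorel, Δ.measurableSet_adj,
    fun x => ?_, Δ.isAcyclic_toSimpleGraph, ⟨{x | Δ.side x = true},
      Δ.measurable_side (measurableSet_singleton true), ?_⟩, le_antisymm ?_ ?_⟩
  · have h1 : (Γ.used x.1.1 x.1.2).ncard ≤ n := by
      cases x.1.2 with
      | nil =>
        change (Γ.colors x.1.1).ncard ≤ n
        rw [FreeProd.ncard_colors_cosetGraph, hcardG]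
        split <;> lia
      | cons a q =>
        simpa [ColoredGraph.used] using hn
    have h2 : Δ.colors x = _ := ColoredGraph.colors_graft x
    rw [Δ.encard_neighborSet, ← (Set.toFinite _).cast_ncard_eq, h2, Set.ncard_union_eq
      (Set.disjoint_compl_right_iff_subset.2 subset_rfl |>.mono_right (hX _)), hXcard _ h1]
    congr 1
    lia
  · rintro x y ⟨a, h⟩
    have key : ∀ b b' : Bool, b ≠ b' → (b = true ↔ ¬ b' = true) := by decide
    exact key _ _ (Δ.side_ne h)
  · exact csInf_le' hmem
  · refine le_csInf ⟨_, hmem⟩ ?_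
    rintro κ ⟨Y, mY, hY, rfl, c, hc, hsymm, hproper⟩
    by_contra! hlt
    have : Finite Y := Cardinal.lt_aleph0_iff_finite.1 (hlt.trans Cardinal.natCast_lt_aleph0)
    let ι (v : FreeProd.Coset G L) : Γ.Graft X := ⟨(v, []), trivial⟩
    have hι : Measurable ι := (measurable_id.prodMk measurable_const).subtype_mk
    have hadj {a v w} (h : FreeProd.cosetRel a v w) : Δ.toSimpleGraph.Adj (ι v) (ι w) :=
      ⟨a, .inl ⟨rfl, rfl, h⟩⟩
    have hle := FreeProd.card_le_of_cosetGraph_coloring (G := G) (L := L)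
      (c := fun p => c (ι p.1, ι p.2))
      hsum
      (hc.comp ((hι.comp measurable_fst).prodMk (hι.comp measurable_snd)))
      (fun a v w h => hsymm _ _ (hadj h))
      (fun a b v w w' h h' hne => hproper _ _ _ (hadj h) (hadj h') fun he =>
        hne (congrArg (fun x => x.1.1) he))
    rw [← Nat.cast_card, Nat.cast_lt] at hlt
    simp only [L, Nat.card_fin] at hle
    lia
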